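/- arXiv:2501.00567 — 3 statements merged into one kernel-verified Lean document; each statement's English description precedes it below -/
import Mathlib

section
/- For every finite triangle-free simple graph G and every weight function w : V(G) → ℝ with w(v) > 0 for every vertex v, there exists a probability distribution p on the independent sets of G such that every vertex v of G is covered with probability at least f(w(N_G(v))/w(v)), where w(N_G(v)) denotes the sum of the weights w(u) over all neighbors u of v in G. -/
open Finset

/-- The Shearer function: `f x = ((1-x) + x·ln x)/(x-1)²` for `x ∈ (0,∞)\{1}`,
`f 1 = 1/2`, and `f x = 1` for `x ≤ 0`. -/
noncomputable def shearerF (x : ℝ) : ℝ :=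
  if x ≤ 0 then 1
  else if x = 1 then 1 / 2
  else ((1 - x) + x * Real.log x) / (x - 1) ^ 2

/-- `I` is an independent set of `G`: no two of its vertices are adjacent. -/
def IsIndepFinset {V : Type*} (G : SimpleGraph V) (I : Finset V) : Prop :=
  ∀ u ∈ I, ∀ v ∈ I, ¬ G.Adj u v

noncomputable def shA (x : ℝ) : ℝ :=
  if x ≤ 0 then 0 else ∫ t in (0:ℝ)..1, t * (1 - t) / (1 - t + x * t) ^ 2

lemma sh_q_pos {x t : ℝ} (hx : 0 < x) (h0 : 0 ≤ t) (h1 : t ≤ 1) : 0 < 1 - t + x * t := by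
  rcases h0.eq_or_lt with h | h
  · subst h; norm_num
  · have := mul_pos hx h
    linarith

lemma sh_q_pos' {x t : ℝ} (hx : 0 < x) (ht : t ∈ Set.uIcc (0:ℝ) 1) : 0 < 1 - t + x * t := by
  rw [Set.uIcc_of_le zero_le_one] at ht
  exact sh_q_pos hx ht.1 ht.2

lemma sh_int1 {x : ℝ} (hx : 0 < x) :
    IntervalIntegrable (fun t : ℝ => (1 - t) / (1 - t + x * t)) MeasureTheory.volume 0 1 := by
  apply ContinuousOn.intervalIntegrable
  apply ContinuousOn.div (by fun_prop) (by fun_prop)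
  intro t ht
  exact (sh_q_pos' hx ht).ne'

lemma sh_int2 {x : ℝ} (hx : 0 < x) :
    IntervalIntegrable (fun t : ℝ => t * (1 - t) / (1 - t + x * t) ^ 2) MeasureTheory.volume 0 1 := by
  apply ContinuousOn.intervalIntegrable
  apply ContinuousOn.div (by fun_prop) (by fun_prop)
  intro t ht
  exact (pow_pos (sh_q_pos' hx ht) 2).ne'

lemma shF_eq {x : ℝ} (hx : 0 < x) :
    shearerF x = ∫ t in (0:ℝ)..1, (1 - t) / (1 - t + x * t) := by
  unfold shearerF
  rw [if_neg (not_le.2 hx)]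
  by_cases h1 : x = 1
  · subst h1
    have := intervalIntegral.integral_eq_sub_of_hasDerivAt
      (f := fun t => t - t ^ 2 / 2)
      (f' := fun t => (1 - t) / (1 - t + 1 * t)) (a := 0) (b := 1) ?_ (sh_int1 hx)
    · rw [this]; norm_num
    · intro t ht
      refine HasDerivAt.congr_deriv
        ((hasDerivAt_id t).sub (((hasDerivAt_id t).pow 2).div_const 2)) ?_
      simp
  · rw [if_neg h1]
    have hc : x - 1 ≠ 0 := sub_ne_zero.2 h1
    have := intervalIntegral.integral_eq_sub_of_hasDerivAt
      (f := fun t => - t / (x - 1) + x / (x - 1) ^ 2 * Real.log (1 - t + x * t))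
      (f' := fun t => (1 - t) / (1 - t + x * t)) (a := 0) (b := 1) ?_ (sh_int1 hx)
    · rw [this]
      norm_num
      field_simp
      ring
    · intro t ht
      have hq := sh_q_pos' hx ht
      have e1 : HasDerivAt (fun t : ℝ => 1 - t + x * t) (x - 1) t := by
        have := ((hasDerivAt_id t).const_sub 1).add ((hasDerivAt_id t).const_mul x)
        exact this.congr_deriv (by ring)
      have := ((hasDerivAt_id t).neg.div_const (x - 1)).add
        ((e1.log hq.ne').const_mul (x / (x - 1) ^ 2))
      refine HasDerivAt.congr_deriv this ?_
      field_simp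
      ring

lemma sh_ode {x : ℝ} (hx : 0 ≤ x) :
    1 - (x + 1) * shearerF x = shA x * (x - x ^ 2) := by
  rcases hx.eq_or_lt with h | hx
  · subst h; simp [shearerF, shA]
  rw [shF_eq hx, shA, if_neg (not_le.2 hx)]
  have := intervalIntegral.integral_eq_sub_of_hasDerivAt
      (f := fun t => - (1 - t) ^ 2 / (1 - t + x * t))
      (f' := fun t => (x + 1) * ((1 - t) / (1 - t + x * t))
        + (x - x ^ 2) * (t * (1 - t) / (1 - t + x * t) ^ 2)) (a := 0) (b := 1) ?_
      (((sh_int1 hx).const_mul _).add ((sh_int2 hx).const_mul _))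
  · rw [intervalIntegral.integral_add ((sh_int1 hx).const_mul _) ((sh_int2 hx).const_mul _),
      intervalIntegral.integral_const_mul, intervalIntegral.integral_const_mul] at this
    norm_num at this
    linarith
  · intro t ht
    have hq := sh_q_pos' hx ht
    have e1 : HasDerivAt (fun t : ℝ => 1 - t + x * t) (x - 1) t := by
      have := ((hasDerivAt_id t).const_sub 1).add ((hasDerivAt_id t).const_mul x)
      exact this.congr_deriv (by ring)
    have e2 : HasDerivAt (fun t : ℝ => - (1 - t) ^ 2) (2 * (1 - t)) t := by
      have := (((hasDerivAt_id t).const_sub 1).pow 2).neg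
      refine HasDerivAt.congr_deriv this ?_
      simp
    refine HasDerivAt.congr_deriv (e2.div e1 hq.ne') ?_
    field_simp
    ring

lemma shA_nonneg (x : ℝ) : 0 ≤ shA x := by
  unfold shA
  split_ifs with h
  · exact le_rfl
  · apply intervalIntegral.integral_nonneg zero_le_one
    intro t ht
    have := ht.1
    have := ht.2
    exact div_nonneg (mul_nonneg ht.1 (by linarith)) (sq_nonneg _)

lemma shF_ge {x : ℝ} (hx : 0 < x) : x * shA x ≤ shearerF x := by
  rw [shF_eq hx, shA, if_neg (not_le.2 hx), ← intervalIntegral.integral_const_mul]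
  apply intervalIntegral.integral_mono_on zero_le_one ((sh_int2 hx).const_mul _) (sh_int1 hx)
  intro t ht
  have hq := sh_q_pos hx ht.1 ht.2
  have h1 := ht.2
  rw [← sub_nonneg]
  have : (1 - t) / (1 - t + x * t) - x * (t * (1 - t) / (1 - t + x * t) ^ 2)
    = (1 - t) ^ 2 / (1 - t + x * t) ^ 2 := by
    field_simp
    ring
  rw [this]
  positivity

lemma shF_zero : shearerF 0 = 1 := by simp [shearerF]

lemma sh_tangent_pt {x y t : ℝ} (hq : 0 < 1 - t + x * t) (hq' : 0 < 1 - t + y * t) :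
    (1 - t) / (1 - t + y * t) - (1 - t) / (1 - t + x * t)
      + (y - x) * (t * (1 - t) / (1 - t + x * t) ^ 2)
    = (y - x) ^ 2 * (t ^ 2 * (1 - t) / ((1 - t + y * t) * (1 - t + x * t) ^ 2)) := by
  have hd : (y - x) * t = (1 - t + y * t) - (1 - t + x * t) := by ring
  generalize 1 - t + x * t = q at *
  generalize 1 - t + y * t = q' at *
  generalize 1 - t = s at *
  have e1 : (y - x) * (t * s / q ^ 2) = ((y - x) * t) * s / q ^ 2 := by ring
  have e2 : (y - x) ^ 2 * (t ^ 2 * s / (q' * q ^ 2)) = ((y - x) * t) ^ 2 * s / (q' * q ^ 2) := by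
    ring
  rw [e1, e2, hd]
  field_simp
  ring

lemma sh_diff_eq {x y : ℝ} (hx : 0 < x) (hy : 0 < y) :
    shearerF y - shearerF x + (y - x) * shA x =
    ∫ t in (0:ℝ)..1, ((1 - t) / (1 - t + y * t) - (1 - t) / (1 - t + x * t)
      + (y - x) * (t * (1 - t) / (1 - t + x * t) ^ 2)) := by
  rw [intervalIntegral.integral_add ((sh_int1 hy).sub (sh_int1 hx)) ((sh_int2 hx).const_mul _),
    intervalIntegral.integral_sub (sh_int1 hy) (sh_int1 hx), intervalIntegral.integral_const_mul,
    shF_eq hx, shF_eq hy, shA, if_neg (not_le.2 hx)]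

lemma sh_int3 {x y : ℝ} (hx : 0 < x) (hy : 0 < y) :
    IntervalIntegrable (fun t : ℝ => (1 - t) / (1 - t + y * t) - (1 - t) / (1 - t + x * t)
      + (y - x) * (t * (1 - t) / (1 - t + x * t) ^ 2)) MeasureTheory.volume 0 1 :=
  ((sh_int1 hy).sub (sh_int1 hx)).add ((sh_int2 hx).const_mul _)

lemma sh_tangent_pos {x y : ℝ} (hx : 0 < x) (hy : 0 < y) :
    0 ≤ shearerF y - shearerF x + (y - x) * shA x := by
  rw [sh_diff_eq hx hy]
  apply intervalIntegral.integral_nonneg zero_le_one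
  intro t ht
  have h1 := ht.2
  have hq := sh_q_pos hx ht.1 ht.2
  have hq' := sh_q_pos hy ht.1 ht.2
  rw [sh_tangent_pt hq hq']
  have : 0 ≤ 1 - t := by linarith
  positivity

lemma shF_le_one {x : ℝ} (hx : 0 ≤ x) : shearerF x + x * shA x ≤ 1 := by
  rcases hx.eq_or_lt with h | hx
  · subst h; simp [shearerF]
  have h1 := sh_ode hx.le
  have h2 := shF_ge hx
  nlinarith

lemma sh_tangent {x y : ℝ} (hy : 0 ≤ y) (hyx : y ≤ x) :
    shearerF x + shA x * (x - y) ≤ shearerF y := by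
  rcases hy.eq_or_lt with h | hy
  · subst h
    have := shF_le_one hyx
    rw [shF_zero]; linarith
  · have := sh_tangent_pos (hy.trans_le hyx) hy
    linarith

lemma sh_quad {x y : ℝ} (hx : 0 < x) (hy : x / 2 < y) :
    shearerF y - shearerF x + (y - x) * shA x ≤ (y - x) ^ 2 * (1 / (min 1 (x/2)) ^ 3) := by
  have hy0 : 0 < y := by linarith
  set m := min 1 (x/2) with hm
  have hm0 : 0 < m := by rw [hm]; apply lt_min <;> linarith
  have hm1 : m ≤ 1 := min_le_left _ _
  have hm2 : m ≤ x / 2 := min_le_right _ _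
  rw [sh_diff_eq hx hy0]
  have := intervalIntegral.integral_mono_on zero_le_one (sh_int3 hx hy0)
    (intervalIntegrable_const (c := (y - x) ^ 2 * (1 / m ^ 3))) ?_
  · simpa using this
  · intro t ht
    have h0 := ht.1
    have h1 := ht.2
    have hq := sh_q_pos hx ht.1 ht.2
    have hq' := sh_q_pos hy0 ht.1 ht.2
    rw [sh_tangent_pt hq hq']
    have a1 : m ≤ 1 - t + x * t := by nlinarith
    have a2 : m ≤ 1 - t + y * t := by nlinarith
    gcongr
    · calc t ^ 2 * (1 - t) ≤ 1 * 1 := by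
            gcongr
            · exact pow_le_one₀ h0 h1
            · linarith
        _ = 1 := by norm_num
    · calc m ^ 3 = m * m ^ 2 := by ring
        _ ≤ _ := by gcongr

lemma shF_hasDerivAt {x : ℝ} (hx : 0 < x) : HasDerivAt shearerF (- shA x) x := by
  rw [hasDerivAt_iff_isLittleO]
  have hO : (fun y => shearerF y - shearerF x - (y - x) • (- shA x)) =O[nhds x]
      (fun y => (y - x) ^ 2) := by
    apply Asymptotics.IsBigO.of_bound (1 / (min 1 (x/2)) ^ 3)
    filter_upwards [lt_mem_nhds (show x / 2 < x by linarith)] with y hy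
    have h1 := sh_quad hx hy
    have h2 := sh_tangent_pos hx (show 0 < y by linarith)
    have e : shearerF y - shearerF x - (y - x) • (- shA x)
      = shearerF y - shearerF x + (y - x) * shA x := by simp
    rw [e, Real.norm_of_nonneg h2, Real.norm_of_nonneg (sq_nonneg _)]
    linarith
  refine hO.trans_isLittleO ?_
  simpa using Asymptotics.isLittleO_pow_sub_sub x (m := 2) (by norm_num)

set_option linter.unusedSectionVars false

section shear
variable {V : Type*} [DecidableEq V] (G : SimpleGraph V) [DecidableRel G.Adj]

def shD (S : Finset V) (w : V → ℝ) (u : V) : ℝ := ∑ z ∈ S, if G.Adj u z then w z else 0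

noncomputable def shPhi (y : V → ℝ) (S : Finset V) (w : V → ℝ) : ℝ :=
  ∑ u ∈ S, y u * shearerF (shD G S w u / w u)

def shC (S : Finset V) (w : V → ℝ) (u v : V) : ℝ :=
  ∑ z ∈ S, if G.Adj u z ∧ G.Adj v z then w z else 0

def shQ (S : Finset V) (w : V → ℝ) (u : V) : ℝ :=
  ∑ z ∈ S, if G.Adj u z then w z * shD G S w z else 0

def shRest (S : Finset V) (v : V) : Finset V := S.filter (fun u => u ≠ v ∧ ¬ G.Adj v u)

lemma shD_nonneg {S : Finset V} {w : V → ℝ} (hw : ∀ v, 0 < w v) (u : V) : 0 ≤ shD G S w u :=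
  Finset.sum_nonneg fun z _ => by split_ifs <;> [exact (hw z).le; exact le_rfl]

lemma shD_le {S : Finset V} {w : V → ℝ} (hw : ∀ v, 0 < w v) (u : V) :
    shD G S w u ≤ ∑ z ∈ S, w z :=
  Finset.sum_le_sum fun z _ => by split_ifs <;> [exact le_rfl; exact (hw z).le]

lemma shC_nonneg {S : Finset V} {w : V → ℝ} (hw : ∀ v, 0 < w v) (u v : V) : 0 ≤ shC G S w u v :=
  Finset.sum_nonneg fun z _ => by split_ifs <;> [exact (hw z).le; exact le_rfl]

lemma shD_rest (S : Finset V) (w : V → ℝ) (u v : V) (huv : ¬ G.Adj v u) :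
    shD G (shRest G S v) w u = shD G S w u - shC G S w u v := by
  unfold shD shC shRest
  rw [Finset.sum_filter, ← Finset.sum_sub_distrib]
  apply Finset.sum_congr rfl
  intro z _
  by_cases hz : z = v
  · subst hz
    have : ¬ G.Adj u z := fun h => huv h.symm
    simp [this]
  · by_cases h1 : G.Adj u z <;> by_cases h2 : G.Adj v z <;> simp [hz, h1, h2]

lemma shC_self (S : Finset V) (w : V → ℝ) (u : V) : shC G S w u u = shD G S w u := by
  simp [shC, shD]

lemma shC_adj (hG : G.CliqueFree 3) (S : Finset V) (w : V → ℝ) (u v : V) (h : G.Adj u v) :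
    shC G S w u v = 0 := by
  apply Finset.sum_eq_zero
  intro z _
  rw [if_neg]
  rintro ⟨h1, h2⟩
  exact hG {u, v, z} (SimpleGraph.is3Clique_triple_iff.2 ⟨h, h1, h2⟩)

lemma shC_sum (S : Finset V) (w : V → ℝ) (u : V) :
    ∑ v ∈ S, w v * shC G S w u v = shQ G S w u := by
  unfold shC shQ shD
  simp_rw [Finset.mul_sum]
  rw [Finset.sum_comm]
  apply Finset.sum_congr rfl
  intro z _
  by_cases h : G.Adj u z
  · simp only [h, true_and, if_true]
    apply Finset.sum_congr rfl
    intro v _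
    by_cases h' : G.Adj v z
    · simp [h', h'.symm, mul_comm]
    · have : ¬ G.Adj z v := fun k => h' k.symm
      simp [h', this]
  · simp [h]

lemma sh_key_u (hG : G.CliqueFree 3) (S : Finset V) (w : V → ℝ) (u : V) (hu : u ∈ S) (f b : ℝ) :
    ∑ v ∈ S, (if u ≠ v ∧ ¬ G.Adj v u then w v * (f + b * shC G S w u v) else 0)
      = f * ((∑ v ∈ S, w v) - w u - shD G S w u) + b * (shQ G S w u - w u * shD G S w u) := by
  have : ∀ v ∈ S, (if u ≠ v ∧ ¬ G.Adj v u then w v * (f + b * shC G S w u v) else 0)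
    = f * w v + b * (w v * shC G S w u v) - (if u = v then w u * (f + b * shD G S w u) else 0)
      - f * (if G.Adj u v then w v else 0) := by
    intro v _
    by_cases h1 : u = v
    · subst h1
      simp [shC_self]; ring
    · by_cases h2 : G.Adj u v
      · simp [h1, h2, h2.symm, shC_adj G hG S w u v h2]
      · have : ¬ G.Adj v u := fun k => h2 k.symm
        simp [h1, h2, this]; ring
  rw [Finset.sum_congr rfl this]
  rw [Finset.sum_sub_distrib, Finset.sum_sub_distrib, Finset.sum_add_distrib, ← Finset.mul_sum,
    ← Finset.mul_sum, ← Finset.mul_sum, shC_sum, Finset.sum_ite_eq, if_pos hu]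
  change _ - f * shD G S w u = _
  ring

lemma sh_key (hG : G.CliqueFree 3) (S : Finset V) (w y : V → ℝ) (hw : ∀ v, 0 < w v)
    (hy : ∀ v, 0 ≤ y v) (A : ℝ)
    (hA : ∀ v ∈ S, y v + shPhi G y (shRest G S v) w ≤ A) :
    (∑ v ∈ S, w v) * shPhi G y S w
      + ∑ u ∈ S, y u * (shA (shD G S w u / w u) / w u) * (shQ G S w u - shD G S w u ^ 2)
      ≤ (∑ v ∈ S, w v) * A := by
  have h1 : ∀ v ∈ S, w v * y v + ∑ u ∈ S, y u * (if u ≠ v ∧ ¬ G.Adj v u then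
      w v * (shearerF (shD G S w u / w u) + shA (shD G S w u / w u) / w u * shC G S w u v) else 0)
      ≤ w v * A := by
    intro v hv
    refine le_trans ?_ (mul_le_mul_of_nonneg_left (hA v hv) (hw v).le)
    rw [mul_add]
    gcongr
    unfold shPhi
    conv_rhs => rw [shRest]
    rw [Finset.mul_sum, Finset.sum_filter]
    apply Finset.sum_le_sum
    intro u hu
    split_ifs with h
    · rw [mul_left_comm]
      have hyu := hy u
      have hwv := (hw v).le
      have hwu := hw u
      gcongr
      have e := shD_rest G S w u v h.2
      change _ ≤ shearerF (shD G (shRest G S v) w u / w u)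
      have t := sh_tangent (x := shD G S w u / w u) (y := shD G (shRest G S v) w u / w u)
        (div_nonneg (shD_nonneg G hw u) hwu.le) (by
          gcongr
          have := shC_nonneg G (S := S) hw u v
          linarith)
      refine le_trans (le_of_eq ?_) t
      rw [e]
      ring
    · simp
  have h2 := Finset.sum_le_sum h1
  rw [Finset.sum_add_distrib, Finset.sum_comm, ← Finset.sum_mul, ← Finset.sum_add_distrib] at h2
  refine le_trans (le_of_eq ?_) h2
  unfold shPhi
  rw [Finset.mul_sum, ← Finset.sum_add_distrib]
  apply Finset.sum_congr rfl
  intro u hu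
  rw [← Finset.mul_sum, sh_key_u G hG S w u hu]
  have hwu := hw u
  have ode := sh_ode (x := shD G S w u / w u) (div_nonneg (shD_nonneg G hw u) hwu.le)
  generalize shD G S w u = D at *
  generalize shQ G S w u = Q at *
  generalize ∑ v ∈ S, w v = W at *
  have hD : D = (D / w u) * w u := by field_simp
  generalize D / w u = x at *
  generalize shA x = a at *
  generalize shearerF x = f at *
  subst hD
  have e : a / w u * (Q - (x * w u) ^ 2) = a / w u * (Q - w u * (x * w u)) + a * (x - x ^ 2) * w u := by
    field_simp
    ring
  rw [mul_assoc (y u), e, ← ode]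
  ring

noncomputable def shX (S : Finset V) (s : V → ℝ) (u : V) : ℝ :=
  ∑ z ∈ S, if G.Adj u z then Real.exp (s z - s u) else 0

lemma shX_eq (S : Finset V) (s : V → ℝ) (u : V) :
    shD G S (fun v => Real.exp (s v)) u / Real.exp (s u) = shX G S s u := by
  unfold shD shX
  rw [Finset.sum_div]
  apply Finset.sum_congr rfl
  intro z _
  split_ifs
  · rw [Real.exp_sub]
  · simp

lemma shX_nonneg (S : Finset V) (s : V → ℝ) (u : V) : 0 ≤ shX G S s u :=
  Finset.sum_nonneg fun z _ => by split_ifs <;> positivity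

lemma shX_pos (S : Finset V) (u : V) (h : ∃ z ∈ S, G.Adj u z) (s : V → ℝ) : 0 < shX G S s u := by
  obtain ⟨z, hz, h⟩ := h
  apply Finset.sum_pos'
  · intro z _
    split_ifs <;> positivity
  · exact ⟨z, hz, by rw [if_pos h]; positivity⟩

lemma shX_zero (S : Finset V) (u : V) (h : ¬ ∃ z ∈ S, G.Adj u z) (s : V → ℝ) : shX G S s u = 0 := by
  push Not at h
  exact Finset.sum_eq_zero fun z hz => by rw [if_neg (h z hz)]

noncomputable def shPsi (y : V → ℝ) (S : Finset V) (s : V → ℝ) : ℝ :=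
  ∑ u ∈ S, y u * shearerF (shX G S s u)

lemma shPsi_eq (y : V → ℝ) (S : Finset V) (s : V → ℝ) :
    shPhi G y S (fun v => Real.exp (s v)) = shPsi G y S s := by
  unfold shPhi shPsi
  simp_rw [shX_eq]

lemma shPsi_le (y : V → ℝ) (hy : ∀ v, 0 ≤ y v) (S : Finset V) (s : V → ℝ) :
    shPsi G y S s ≤ ∑ u ∈ S, y u := by
  apply Finset.sum_le_sum
  intro u _
  have h0 := shX_nonneg G S s u
  have h1 := shF_le_one h0
  have h2 := mul_nonneg h0 (shA_nonneg (shX G S s u))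
  exact mul_le_of_le_one_right (hy u) (by linarith)

lemma shPsi_cont (y : V → ℝ) (S : Finset V) : Continuous (shPsi G y S) := by
  unfold shPsi
  refine continuous_finsetSum _ fun u _ => Continuous.mul continuous_const ?_
  by_cases h : ∃ z ∈ S, G.Adj u z
  · have hc : Continuous fun s => shX G S s u := by
      unfold shX
      refine continuous_finsetSum _ fun z _ => ?_
      split_ifs <;> fun_prop
    rw [continuous_iff_continuousAt]
    intro s
    exact ContinuousAt.comp (f := fun s => shX G S s u)
      (shF_hasDerivAt (shX_pos G S u h s)).continuousAt hc.continuousAt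
  · simp_rw [shX_zero G S u h]
    exact continuous_const

lemma shPsi_deriv (y : V → ℝ) (S : Finset V) (s d : V → ℝ) :
    HasDerivAt (fun t : ℝ => shPsi G y S (fun v => s v + t * d v))
      (∑ u ∈ S, y u * (- shA (shX G S s u) *
        ∑ z ∈ S, if G.Adj u z then Real.exp (s z - s u) * (d z - d u) else 0)) 0 := by
  unfold shPsi
  refine HasDerivAt.fun_sum fun u _ => HasDerivAt.const_mul _ ?_
  by_cases h : ∃ z ∈ S, G.Adj u z
  · have hX : HasDerivAt (fun t : ℝ => shX G S (fun v => s v + t * d v) u)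
        (∑ z ∈ S, if G.Adj u z then Real.exp (s z - s u) * (d z - d u) else 0) 0 := by
      unfold shX
      refine HasDerivAt.fun_sum fun z _ => ?_
      split_ifs
      · have h1 : HasDerivAt (fun t : ℝ => (s z + t * d z) - (s u + t * d u)) (d z - d u) 0 := by
          have a1 := ((hasDerivAt_id (0:ℝ)).mul_const (d z)).const_add (s z)
          have a2 := ((hasDerivAt_id (0:ℝ)).mul_const (d u)).const_add (s u)
          exact (a1.sub a2).congr_deriv (by ring)
        have := h1.exp
        simpa using this
      · exact hasDerivAt_const _ _
    have e : (fun v => s v + (0:ℝ) * d v) = s := by ext; simp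
    have hF := shF_hasDerivAt (shX_pos G S u h (fun v => s v + (0:ℝ) * d v))
    have := HasDerivAt.comp (0:ℝ) hF hX
    simp only [e] at this
    exact this
  · simp_rw [shX_zero G S u h]
    push Not at h
    rw [Finset.sum_eq_zero fun z hz => by rw [if_neg (h z hz)]]
    simpa using hasDerivAt_const (0:ℝ) (shearerF 0)

end shear

lemma sh_exists_max {V : Type*} [Fintype V] (Ψ : (V → ℝ) → ℝ) (hc : Continuous Ψ) (B : ℝ)
    (hB : ∀ s, Ψ s ≤ B) (η : ℝ) (hη : 0 < η) :
    ∃ s, ∀ s', Ψ s' - η * ∑ v, s' v ^ 2 ≤ Ψ s - η * ∑ v, s v ^ 2 := by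
  apply Continuous.exists_forall_ge' (by fun_prop) (0 : V → ℝ)
  have ht := tendsto_norm_cocompact_atTop (E := V → ℝ)
  filter_upwards [ht.eventually_ge_atTop (max 1 ((B - Ψ 0) / η))] with s hs
  have h1 : 1 ≤ ‖s‖ := le_trans (le_max_left _ _) hs
  have h2 : (B - Ψ 0) / η ≤ ‖s‖ := le_trans (le_max_right _ _) hs
  rw [div_le_iff₀ hη] at h2
  have h3 : ‖s‖ ^ 2 ≤ ∑ v, s v ^ 2 := by
    have hsq : 0 ≤ ∑ v, s v ^ 2 := Finset.sum_nonneg fun v _ => sq_nonneg _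
    have : ‖s‖ ≤ Real.sqrt (∑ v, s v ^ 2) := by
      rw [pi_norm_le_iff_of_nonneg (Real.sqrt_nonneg _)]
      intro v
      rw [Real.norm_eq_abs]
      apply Real.abs_le_sqrt
      exact Finset.single_le_sum (f := fun v => s v ^ 2) (fun v _ => sq_nonneg _) (Finset.mem_univ v)
    calc ‖s‖ ^ 2 ≤ Real.sqrt (∑ v, s v ^ 2) ^ 2 := by gcongr
      _ = _ := Real.sq_sqrt hsq
  have h4 := hB s
  have h5 : B - Ψ 0 ≤ η * ∑ v, s v ^ 2 := by
    calc B - Ψ 0 ≤ ‖s‖ * η := h2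
      _ ≤ ‖s‖ ^ 2 * η := by gcongr; nlinarith
      _ ≤ (∑ v, s v ^ 2) * η := by gcongr
      _ = _ := mul_comm _ _
  simp
  linarith

section shear2
variable {V : Type*} [Fintype V] [DecidableEq V] (G : SimpleGraph V) [DecidableRel G.Adj]

lemma sh_crit (hG : G.CliqueFree 3) (S : Finset V) (hS : S.Nonempty) (y : V → ℝ)
    (hy : ∀ v, 0 ≤ y v) (A : ℝ)
    (hA : ∀ w : V → ℝ, (∀ v, 0 < w v) → ∀ v ∈ S, y v + shPhi G y (shRest G S v) w ≤ A)
    (η : ℝ) (hη : 0 < η) (s : V → ℝ)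
    (hs : ∀ s', shPsi G y S s' - η * ∑ v, s' v ^ 2 ≤ shPsi G y S s - η * ∑ v, s v ^ 2) :
    shPsi G y S s ≤ A + 2 * η * ∑ v, |s v| := by
  set w : V → ℝ := fun v => Real.exp (s v) with hw
  have hw0 : ∀ v, 0 < w v := fun v => Real.exp_pos _
  set W := ∑ v ∈ S, w v with hW
  have hW0 : 0 < W := Finset.sum_pos (fun v _ => hw0 v) hS
  set d : V → ℝ := fun v => shD G S w v / W with hd
  have hder := shPsi_deriv G y S s d
  have hq : HasDerivAt (fun t : ℝ => η * ∑ v, (s v + t * d v) ^ 2) (η * ∑ v, 2 * (s v * d v)) 0 := by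
    refine HasDerivAt.const_mul _ (HasDerivAt.fun_sum fun v _ => ?_)
    have a1 := (((hasDerivAt_id (0:ℝ)).mul_const (d v)).const_add (s v)).pow 2
    exact a1.congr_deriv (by simp; ring)
  have hmax : IsLocalMax (fun t : ℝ => shPsi G y S (fun v => s v + t * d v)
      - η * ∑ v, (s v + t * d v) ^ 2) 0 := by
    apply Filter.Eventually.of_forall
    intro t
    have := hs (fun v => s v + t * d v)
    simpa using this
  have h0 := hmax.hasDerivAt_eq_zero (hder.sub hq)
  have key := sh_key G hG S w y hw0 hy A (hA w hw0)
  rw [shPsi_eq] at key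
  have e1 : ∑ u ∈ S, y u * (shA (shD G S w u / w u) / w u) * (shQ G S w u - shD G S w u ^ 2)
      = - W * ∑ u ∈ S, y u * (- shA (shX G S s u) *
        ∑ z ∈ S, if G.Adj u z then Real.exp (s z - s u) * (d z - d u) else 0) := by
    rw [Finset.mul_sum]
    apply Finset.sum_congr rfl
    intro u _
    have hx : shD G S w u / w u = shX G S s u := shX_eq G S s u
    rw [hx]
    have : (shQ G S w u - shD G S w u ^ 2) = W * w u *
        ∑ z ∈ S, if G.Adj u z then Real.exp (s z - s u) * (d z - d u) else 0 := by
      rw [sq]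
      conv_lhs => rw [shQ]; rhs; lhs; rw [shD]
      rw [Finset.sum_mul, ← Finset.sum_sub_distrib, Finset.mul_sum]
      apply Finset.sum_congr rfl
      intro z _
      split_ifs
      · rw [Real.exp_sub]
        change _ = W * w u * (w z / w u * (shD G S w z / W - shD G S w u / W))
        have := (hw0 u).ne'
        field_simp
      · simp
    rw [this]
    have := (hw0 u).ne'
    field_simp
  rw [e1] at key
  have e2 : ∑ u ∈ S, y u * (- shA (shX G S s u) *
        ∑ z ∈ S, if G.Adj u z then Real.exp (s z - s u) * (d z - d u) else 0)
      ≤ 2 * η * ∑ v, |s v| := by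
    rw [sub_eq_zero.1 h0, mul_comm 2 η, mul_assoc]
    gcongr
    rw [Finset.mul_sum]
    gcongr with v _
    have hd0 : 0 ≤ d v := div_nonneg (shD_nonneg G hw0 v) hW0.le
    have hd1 : d v ≤ 1 := (div_le_one hW0).2 (shD_le G hw0 v)
    calc s v * d v ≤ |s v| * d v := by gcongr; exact le_abs_self _
      _ ≤ |s v| := mul_le_of_le_one_right (abs_nonneg _) hd1
  generalize ∑ u ∈ S, y u * (- shA (shX G S s u) *
        ∑ z ∈ S, if G.Adj u z then Real.exp (s z - s u) * (d z - d u) else 0) = E at *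
  have : shPsi G y S s - E ≤ A := by
    apply le_of_mul_le_mul_left _ hW0
    linarith
  linarith

lemma sh_step (hG : G.CliqueFree 3) (S : Finset V) (hS : S.Nonempty) (y : V → ℝ)
    (hy : ∀ v, 0 ≤ y v) (A : ℝ)
    (hA : ∀ w : V → ℝ, (∀ v, 0 < w v) → ∀ v ∈ S, y v + shPhi G y (shRest G S v) w ≤ A)
    (s₀ : V → ℝ) : shPsi G y S s₀ ≤ A := by
  set B := ∑ u ∈ S, y u with hB
  set P := shPsi G y S s₀ with hP
  set N := ∑ v, s₀ v ^ 2 with hN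
  have main : ∀ r : ℝ, 0 < r →
      P ≤ A + r * (Fintype.card V + (B - P + r ^ 2 * N)) + r ^ 2 * N := by
    intro r hr
    have hη : 0 < r ^ 2 := by positivity
    obtain ⟨s, hs⟩ := sh_exists_max _ (shPsi_cont G y S) B (shPsi_le G y hy S) _ hη
    have h1 := sh_crit G hG S hS y hy A hA _ hη s hs
    have h2 := hs s₀
    have h3 := shPsi_le G y hy S s
    have h4 : 2 * r ^ 2 * ∑ v, |s v| ≤ r * (Fintype.card V + r ^ 2 * ∑ v, s v ^ 2) := by
      have : ∀ v ∈ (Finset.univ : Finset V), 2 * r ^ 2 * |s v| ≤ r * (1 + r ^ 2 * s v ^ 2) := by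
        intro v _
        have := sq_nonneg (1 - r * |s v|)
        have h := sq_abs (s v)
        have : 0 ≤ r * (1 - r * |s v|) ^ 2 := by positivity
        rw [← h]
        nlinarith
      have := Finset.sum_le_sum this
      rw [← Finset.mul_sum, ← Finset.mul_sum, Finset.sum_add_distrib, ← Finset.mul_sum] at this
      simpa using this
    have hpos : 0 ≤ r ^ 2 * ∑ v, s v ^ 2 :=
      mul_nonneg hη.le (Finset.sum_nonneg fun v _ => sq_nonneg _)
    have h5 : r ^ 2 * ∑ v, s v ^ 2 ≤ B - P + r ^ 2 * N := by linarith
    have h6 : r * (Fintype.card V + r ^ 2 * ∑ v, s v ^ 2)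
      ≤ r * (Fintype.card V + (B - P + r ^ 2 * N)) := by gcongr
    linarith
  have hcont : Continuous fun r : ℝ =>
      A + r * (Fintype.card V + (B - P + r ^ 2 * N)) + r ^ 2 * N := by fun_prop
  have ht : Filter.Tendsto (fun r : ℝ =>
      A + r * (Fintype.card V + (B - P + r ^ 2 * N)) + r ^ 2 * N)
      (nhdsWithin 0 (Set.Ioi 0)) (nhds A) := by
    have := (hcont.tendsto 0).mono_left (nhdsWithin_le_nhds (s := Set.Ioi 0))
    simpa using this
  refine ge_of_tendsto ht ?_
  filter_upwards [self_mem_nhdsWithin] with r hr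
  exact main r hr

lemma sh_dual (hG : G.CliqueFree 3) (y : V → ℝ) (hy : ∀ v, 0 ≤ y v) (S : Finset V) :
    ∀ w : V → ℝ, (∀ v, 0 < w v) →
      ∃ I ⊆ S, IsIndepFinset G I ∧ shPhi G y S w ≤ ∑ v ∈ I, y v := by
  classical
  induction S using Finset.strongInduction with
  | H S ih =>
    intro w hw
    rcases S.eq_empty_or_nonempty with h | hS
    · subst h
      exact ⟨∅, by simp, by simp [IsIndepFinset], by simp [shPhi]⟩
    · obtain ⟨I, hI, hmax⟩ := Finset.exists_max_image
        (S.powerset.filter (fun I => IsIndepFinset G I)) (fun I => ∑ v ∈ I, y v)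
        ⟨∅, Finset.mem_filter.2 ⟨by simp, by intro u hu; simp at hu⟩⟩
      simp only [Finset.mem_filter, Finset.mem_powerset] at hI hmax
      refine ⟨I, hI.1, hI.2, ?_⟩
      have hlog : w = fun v => Real.exp (Real.log (w v)) := by
        ext v; rw [Real.exp_log (hw v)]
      rw [hlog, shPsi_eq]
      apply sh_step G hG S hS y hy
      intro w' hw' v hv
      have hsub : shRest G S v ⊂ S := by
        unfold shRest
        rw [Finset.filter_ssubset]
        exact ⟨v, hv, by simp⟩
      obtain ⟨J, hJ, hJi, hJs⟩ := ih _ hsub w' hw'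
      have hJr : ∀ u ∈ J, u ∈ S ∧ u ≠ v ∧ ¬ G.Adj v u := by
        intro u hu
        have := hJ hu
        simpa [shRest] using this
      have hvJ : v ∉ J := fun h => (hJr v h).2.1 rfl
      have := hmax (insert v J) ⟨?_, ?_⟩
      · rw [Finset.sum_insert hvJ] at this
        linarith
      · intro u hu
        rcases Finset.mem_insert.1 hu with rfl | hu
        · exact hv
        · exact (hJr u hu).1
      · intro a ha b hb
        rcases Finset.mem_insert.1 ha with h1 | ha' <;>
          rcases Finset.mem_insert.1 hb with h2 | hb'
        · subst h1; subst h2; exact G.loopless.irrefl _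
        · subst h1; exact (hJr b hb').2.2
        · subst h2; exact fun h => (hJr a ha').2.2 h.symm
        · exact hJi a ha' b hb'

end shear2

/-- Finite LP duality for covering by sets from a family. -/
lemma sh_lp {V : Type*} [Fintype V] [DecidableEq V] (P : Finset V → Prop) (t : V → ℝ)
    (h : ∀ y : V → ℝ, (∀ v, 0 ≤ y v) → ∃ I, P I ∧ ∑ v, y v * t v ≤ ∑ v ∈ I, y v) :
    ∃ p : Finset V → ℝ, (∀ I, 0 ≤ p I) ∧ (∀ I, p I ≠ 0 → P I) ∧ (∑ I : Finset V, p I) = 1 ∧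
      ∀ v : V, t v ≤ ∑ I ∈ Finset.univ.filter (fun I : Finset V => v ∈ I), p I := by
  classical
  let L : (Finset V → ℝ) →ₗ[ℝ] (V → ℝ) :=
    { toFun := fun p v => ∑ I ∈ Finset.univ.filter (fun I : Finset V => v ∈ I), p I
      map_add' := by intro p q; ext v; simp [Finset.sum_add_distrib]
      map_smul' := by intro c p; ext v; simp [Finset.mul_sum] }
  have hLc : Continuous L := LinearMap.continuous_of_finiteDimensional L
  let Z : Set (Finset V → ℝ) := stdSimplex ℝ (Finset V) ∩ {p | ∀ I, ¬ P I → p I = 0}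
  have hZc : IsCompact Z := by
    apply (isCompact_stdSimplex ℝ (Finset V)).inter_right
    have : {p : Finset V → ℝ | ∀ I, ¬ P I → p I = 0} = ⋂ I, ⋂ (_ : ¬ P I), {p | p I = 0} := by
      ext; simp
    rw [this]
    exact isClosed_iInter fun I => isClosed_iInter fun _ =>
      isClosed_eq (continuous_apply I) continuous_const
  have hZv : Convex ℝ Z := by
    apply (convex_stdSimplex ℝ (Finset V)).inter
    intro p hp q hq a b _ _ _ I hI
    simp [hp I hI, hq I hI]
  by_contra hcon
  have hdisj : Disjoint (L '' Z) (Set.Ici t) := by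
    rw [Set.disjoint_left]
    rintro _ ⟨p, hp, rfl⟩ ht
    exact hcon ⟨p, hp.1.1, fun I hI => by_contra fun h => hI (hp.2 I h), hp.1.2, fun v => ht v⟩
  obtain ⟨f, a, b, h1, hab, h2⟩ := geometric_hahn_banach_compact_closed
    (hZv.linear_image L) (hZc.image hLc) (convex_Ici t) isClosed_Ici hdisj
  let y : V → ℝ := fun v => f (Pi.single v 1)
  have hf : ∀ x : V → ℝ, f x = ∑ v, y v * x v := by
    intro x
    conv_lhs => rw [pi_eq_sum_univ' x]
    rw [map_sum]
    apply Finset.sum_congr rfl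
    intro v _
    rw [map_smul, smul_eq_mul, mul_comm]
  have hy : ∀ v, 0 ≤ y v := by
    intro v
    by_contra hneg
    push Not at hneg
    have hk : ∀ k : ℝ, 0 ≤ k → b < f t + k * y v := by
      intro k hk
      have := h2 (t + k • Pi.single v 1) (by
        rw [Set.mem_Ici]
        have : (0 : V → ℝ) ≤ k • Pi.single v 1 := by
          intro u
          simp only [Pi.smul_apply, Pi.single_apply, smul_eq_mul, Pi.zero_apply]
          split_ifs <;> simp [hk]
        exact le_add_of_nonneg_right this)
      rwa [map_add, map_smul, smul_eq_mul] at this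
    have hb := hk 0 le_rfl
    have := hk ((f t - b) / (- y v)) (div_nonneg (by linarith) (by linarith))
    have hne := hneg.ne
    have e : (f t - b) / (- y v) * y v = - (f t - b) := by field_simp
    rw [e] at this
    linarith
  obtain ⟨I, hI, hIy⟩ := h y hy
  have hp : Pi.single I (1:ℝ) ∈ Z := by
    refine ⟨single_mem_stdSimplex ℝ I, ?_⟩
    intro J hJ
    have : J ≠ I := fun h => hJ (h ▸ hI)
    simp [this]
  have h3 := h1 _ ⟨_, hp, rfl⟩
  have h4 := h2 t (Set.mem_Ici.2 le_rfl)
  rw [hf] at h3 h4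
  have e : ∑ v, y v * L (Pi.single I 1) v = ∑ v ∈ I, y v := by
    have : ∀ v, L (Pi.single I 1) v = if v ∈ I then 1 else 0 := by
      intro v
      change ∑ J ∈ Finset.univ.filter (fun J : Finset V => v ∈ J), (Pi.single I 1 : Finset V → ℝ) J = _
      simp [Pi.single_apply]
    simp [this]
  rw [e] at h3
  linarith

/-- Theorem 2.1 / key technical theorem: for every finite triangle-free
graph `G` and strictly positive vertex weights `w`, there is a probability distribution on
the independent sets of `G` covering each vertex `v` with probability at least
`f(w(N_G(v))/w(v))`. -/
theorem weighted_local_shearer {V : Type*} [Fintype V] [DecidableEq V]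
    (G : SimpleGraph V) [DecidableRel G.Adj] (hG : G.CliqueFree 3)
    (w : V → ℝ) (hw : ∀ v, 0 < w v) :
    ∃ p : Finset V → ℝ,
      (∀ I, 0 ≤ p I) ∧
      (∀ I, p I ≠ 0 → IsIndepFinset G I) ∧
      (∑ I : Finset V, p I) = 1 ∧
      ∀ v : V,
        shearerF ((∑ u ∈ G.neighborFinset v, w u) / w v) ≤
          ∑ I ∈ Finset.univ.filter (fun I : Finset V => v ∈ I), p I := by
  apply sh_lp (fun I => IsIndepFinset G I)
  intro y hy
  obtain ⟨I, -, hI, h⟩ := sh_dual G hG y hy Finset.univ w hw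
  refine ⟨I, hI, le_trans (le_of_eq ?_) h⟩
  unfold shPhi
  apply Finset.sum_congr rfl
  intro v _
  congr 3
  rw [shD, ← Finset.sum_filter]
  apply Finset.sum_congr _ (fun _ _ => rfl)
  ext u
  simp
end

section
/- For every ε ∈ (0,1) there exists a natural number D ≥ 2 such that every finite triangle-free simple graph G admits a probability distribution p on its independent sets under which every vertex v of G with degree d_G(v) ≥ D is covered with probability at least (1−ε)·ln(d_G(v))/d_G(v). -/
open Finset

/-- The truncated Shearer function. -/
noncomputable def shF (x : ℝ) : ℝ := ∫ t in (0:ℝ)..(1/2), (1 - t) / (1 + (x - 1) * t)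

/-- Minus the derivative of the truncated Shearer function. -/
noncomputable def shG (x : ℝ) : ℝ :=
  ∫ t in (0:ℝ)..(1/2), t * (1 - t) / (1 + (x - 1) * t) ^ 2

lemma sh_den {x t : ℝ} (hx : 0 ≤ x) (ht : t ∈ Set.Icc (0:ℝ) (1/2)) :
    0 < 1 + (x - 1) * t := by
  obtain ⟨h0, h1⟩ := ht
  nlinarith [mul_nonneg hx h0]

lemma shF_int {x : ℝ} (hx : 0 ≤ x) :
    IntervalIntegrable (fun t : ℝ => (1 - t) / (1 + (x - 1) * t)) MeasureTheory.volume 0 (1/2) := by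
  apply ContinuousOn.intervalIntegrable
  rw [Set.uIcc_of_le (by norm_num)]
  exact ContinuousOn.div (by fun_prop) (by fun_prop) (fun t ht => (sh_den hx ht).ne')

lemma shG_int {x : ℝ} (hx : 0 ≤ x) :
    IntervalIntegrable (fun t : ℝ => t * (1 - t) / (1 + (x - 1) * t) ^ 2)
      MeasureTheory.volume 0 (1/2) := by
  apply ContinuousOn.intervalIntegrable
  rw [Set.uIcc_of_le (by norm_num)]
  exact ContinuousOn.div (by fun_prop) (by fun_prop) (fun t ht => (pow_pos (sh_den hx ht) 2).ne')

lemma shF_le_one_s2 {x : ℝ} (hx : 0 ≤ x) : shF x ≤ 1 := by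
  have h : shF x ≤ ∫ t in (0:ℝ)..(1/2), (1:ℝ) := by
    apply intervalIntegral.integral_mono_on (by norm_num) (shF_int hx) (by simp)
    intro t ht
    rw [div_le_one (sh_den hx ht)]
    nlinarith [mul_nonneg hx ht.1]
  rw [intervalIntegral.integral_const] at h
  norm_num at h
  linarith

lemma shF_nonneg {x : ℝ} (hx : 0 ≤ x) : 0 ≤ shF x := by
  apply intervalIntegral.integral_nonneg (by norm_num)
  intro t ht
  exact div_nonneg (by linarith [ht.2]) (sh_den hx ht).le

lemma shG_nonneg {x : ℝ} (hx : 0 ≤ x) : 0 ≤ shG x := by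
  apply intervalIntegral.integral_nonneg (by norm_num)
  intro t ht
  exact div_nonneg (mul_nonneg ht.1 (by linarith [ht.2])) (pow_pos (sh_den hx ht) 2).le

lemma mul_shG_le_one {x : ℝ} (hx : 0 ≤ x) : x * shG x ≤ 1 := by
  have h : x * shG x ≤ ∫ t in (0:ℝ)..(1/2), (1:ℝ) := by
    rw [shG, ← intervalIntegral.integral_const_mul]
    apply intervalIntegral.integral_mono_on (by norm_num) ((shG_int hx).const_mul x) (by simp)
    intro t ht
    have := sh_den hx ht
    rw [← mul_div_assoc, div_le_one (by positivity)]
    have h1 : 0 ≤ x * t := mul_nonneg hx ht.1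
    have h2 : 0 ≤ 1 - t := by linarith [ht.2]
    have e : 1 + (x - 1) * t = x * t + (1 - t) := by ring
    rw [e]
    nlinarith [mul_nonneg h1 h2, sq_nonneg (x*t), sq_nonneg (1-t)]
  rw [intervalIntegral.integral_const] at h
  norm_num at h
  linarith

lemma shF_tangent {x y : ℝ} (hx : 0 ≤ x) (hy : 0 ≤ y) :
    shF x - shG x * (y - x) ≤ shF y := by
  have e : shF x - shG x * (y - x) = ∫ t in (0:ℝ)..(1/2),
      ((1 - t) / (1 + (x - 1) * t) - t * (1 - t) / (1 + (x - 1) * t) ^ 2 * (y - x)) := by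
    rw [intervalIntegral.integral_sub (shF_int hx) ((shG_int hx).mul_const _),
      intervalIntegral.integral_mul_const]
    rfl
  rw [e]
  apply intervalIntegral.integral_mono_on (by norm_num)
    ((shF_int hx).sub ((shG_int hx).mul_const _)) (shF_int hy)
  intro t ht
  have h1 := sh_den hx ht
  have h2 := sh_den hy ht
  have h3 : 0 ≤ 1 - t := by linarith [ht.2]
  have key : (1 - t) / (1 + (y - 1) * t) - ((1 - t) / (1 + (x - 1) * t)
      - t * (1 - t) / (1 + (x - 1) * t) ^ 2 * (y - x)) =
      (1 - t) * (t * (y - x)) ^ 2 / ((1 + (y - 1) * t) * (1 + (x - 1) * t) ^ 2) := by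
    have h1' := h1.ne'
    have h2' := h2.ne'
    obtain ⟨s, hs⟩ : ∃ s, s = 1 + (x - 1) * t := ⟨_, rfl⟩
    obtain ⟨r, hr⟩ : ∃ r, r = 1 + (y - 1) * t := ⟨_, rfl⟩
    rw [← hs] at h1' ⊢
    rw [← hr] at h2' ⊢
    field_simp
    subst hs hr
    ring
  have : 0 ≤ (1 - t) * (t * (y - x)) ^ 2 / ((1 + (y - 1) * t) * (1 + (x - 1) * t) ^ 2) := by
    positivity
  linarith

lemma shF_ode {x : ℝ} (hx : 0 ≤ x) :
    0 ≤ 1 - shF x - shF x * x - shG x * x + shG x * x ^ 2 := by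
  have hd : ∀ t ∈ Set.uIcc (0:ℝ) (1/2), HasDerivAt (fun t : ℝ => (1 - t) ^ 2 / (1 + (x - 1) * t))
      (-(1 + x) * ((1 - t) / (1 + (x - 1) * t))
        + x * (x - 1) * (t * (1 - t) / (1 + (x - 1) * t) ^ 2)) t := by
    intro t ht
    rw [Set.uIcc_of_le (by norm_num)] at ht
    have h1 := sh_den hx ht
    have ha : HasDerivAt (fun t : ℝ => (1 - t) ^ 2) (2 * (1 - t) * (-1)) t := by
      have := ((hasDerivAt_id t).const_sub 1).pow 2
      refine this.congr_deriv ?_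
      norm_num
    have hb : HasDerivAt (fun t : ℝ => 1 + (x - 1) * t) (x - 1) t := by
      have := ((hasDerivAt_id t).const_mul (x - 1)).const_add 1
      simpa using this
    have := ha.div hb h1.ne'
    refine this.congr_deriv ?_
    have h1' := h1.ne'
    obtain ⟨s, hs⟩ : ∃ s, s = 1 + (x - 1) * t := ⟨_, rfl⟩
    rw [← hs] at h1' ⊢
    field_simp
    subst hs
    ring
  have hi := intervalIntegral.integral_eq_sub_of_hasDerivAt hd
    (((shF_int hx).const_mul _).add ((shG_int hx).const_mul _))
  rw [intervalIntegral.integral_add ((shF_int hx).const_mul _) ((shG_int hx).const_mul _),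
    intervalIntegral.integral_const_mul, intervalIntegral.integral_const_mul] at hi
  change -(1 + x) * shF x + x * (x - 1) * shG x = _ at hi
  have hp : 0 ≤ (1 - (1/2:ℝ)) ^ 2 / (1 + (x - 1) * (1/2)) :=
    div_nonneg (by positivity) (by linarith)
  norm_num at hi hp
  nlinarith

lemma shF_lower {x : ℝ} (hx : 1 ≤ x) : (Real.log x - 2) / x ≤ shF x := by
  have hx0 : 0 < x := by linarith
  have hden : ∀ t ∈ Set.Icc (0:ℝ) (1/2), 0 < 1 + x * t := fun t ht => by
    have := mul_nonneg hx0.le ht.1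
    linarith
  have hI : IntervalIntegrable (fun t : ℝ => (1 + x * t)⁻¹ - 1 / x) MeasureTheory.volume 0 (1/2) := by
    apply ContinuousOn.intervalIntegrable
    rw [Set.uIcc_of_le (by norm_num)]
    exact ContinuousOn.sub (ContinuousOn.inv₀ (by fun_prop) (fun t ht => (hden t ht).ne')) (by fun_prop)
  have hle : (∫ t in (0:ℝ)..(1/2), ((1 + x * t)⁻¹ - 1 / x)) ≤ shF x := by
    apply intervalIntegral.integral_mono_on (by norm_num) hI (shF_int hx0.le)
    intro t ht
    have h1 := hden t ht
    have h2 := sh_den hx0.le ht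
    have h3 : (1 - t) / (1 + x * t) ≤ (1 - t) / (1 + (x - 1) * t) := by
      apply div_le_div_of_nonneg_left (by linarith [ht.2]) h2
      linarith [ht.1]
    refine le_trans ?_ h3
    have : (1 - t) / (1 + x * t) - ((1 + x * t)⁻¹ - 1 / x) = 1 / (x * (1 + x * t)) := by
      have h1' := h1.ne'
      obtain ⟨s, hs⟩ : ∃ s, s = 1 + x * t := ⟨_, rfl⟩
      rw [← hs] at h1' ⊢
      field_simp
      subst hs
      ring
    have : 0 < 1 / (x * (1 + x * t)) := by positivity
    linarith
  have hd : ∀ t ∈ Set.uIcc (0:ℝ) (1/2),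
      HasDerivAt (fun t : ℝ => Real.log (1 + x * t) / x - t / x) ((1 + x * t)⁻¹ - 1 / x) t := by
    intro t ht
    rw [Set.uIcc_of_le (by norm_num)] at ht
    have hb : HasDerivAt (fun t : ℝ => 1 + x * t) x t := by
      have := ((hasDerivAt_id t).const_mul x).const_add 1
      simpa using this
    have h1 := hden t ht
    have := ((hb.log h1.ne').div_const x).sub ((hasDerivAt_id t).div_const x)
    refine this.congr_deriv ?_
    have h1' := h1.ne'
    obtain ⟨s, hs⟩ : ∃ s, s = 1 + x * t := ⟨_, rfl⟩
    rw [← hs] at h1' ⊢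
    field_simp
  rw [intervalIntegral.integral_eq_sub_of_hasDerivAt hd hI] at hle
  refine le_trans ?_ hle
  have hl : Real.log x - 1 ≤ Real.log (1 + x * (1/2)) := by
    have : Real.log (x / 2) ≤ Real.log (1 + x * (1/2)) := 
      Real.log_le_log (by positivity) (by linarith)
    rw [Real.log_div hx0.ne' (by norm_num)] at this
    have := Real.log_two_lt_d9
    linarith
  have : Real.log (1 + x * (1 / 2)) / x - 1 / 2 / x - (Real.log (1 + x * 0) / x - 0 / x)
    = (Real.log (1 + x * (1/2)) - 1/2) / x := by
    simp
    ring
  rw [this]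
  apply div_le_div_of_nonneg_right _ hx0.le
  linarith

/-- Total weight of the neighbours of `u`. -/
def nbS {V : Type} [Fintype V] (G : SimpleGraph V) [DecidableRel G.Adj] (w : V → ℝ) (u : V) : ℝ :=
  ∑ x, if G.Adj u x then w x else 0

/-- Indicator vectors of independent sets contained in the support of `w`. -/
def indVec {V : Type} [DecidableEq V] (G : SimpleGraph V) (w : V → ℝ) : Set (V → ℝ) :=
  {q | ∃ I : Finset V, IsIndepFinset G I ∧ (∀ v ∈ I, w v ≠ 0) ∧
    q = fun v => if v ∈ I then (1:ℝ) else 0}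

/-- The weight `w` admits a distribution with defect at most `c`. -/
def ShGood {V : Type} [Fintype V] [DecidableEq V] (G : SimpleGraph V) [DecidableRel G.Adj]
    (w : V → ℝ) (c : ℝ) : Prop :=
  ∃ q ∈ convexHull ℝ (indVec G w), ∀ u, 0 < w u → shF (nbS G w u / w u) - c ≤ q u

lemma step_arith (f g k wu S Q h c η A B D e : ℝ) (hk : k * wu = g) (hk0 : 0 ≤ k)
    (hwu : 0 < wu) (hS : 0 ≤ S) (hS1 : S ≤ 1) (hQ : 0 ≤ Q) (h0 : 0 < h) (h1 : h < 1)
    (hD : D * wu = S) (hDg : D * g ≤ 1) (he : e * (1 + h * S) = 1) (he0 : 0 ≤ e)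
    (ode : 0 ≤ 1 - f - f * D - g * D + g * D ^ 2)
    (hA : f - η + k * Q - wu * (f + k * S - 1) - S * f ≤ A)
    (hB : f - k * e * h * (Q - S ^ 2) - c ≤ B) :
    f - ((1 - h) * c + h * η + 2 * h ^ 2) ≤ h * A + (1 - h) * B := by
  have ode' : 0 ≤ wu - f * wu - f * S - g * S + k * S ^ 2 := by
    have := mul_nonneg hwu.le ode
    have e1 : wu * (1 - f - f * D - g * D + g * D ^ 2) = 
      wu - f * wu - f * S - g * S + k * S ^ 2 := by
      rw [← hD, ← hk]; ring
    linarith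
  have kS : k * S ^ 2 ≤ 1 := by
    have e1 : k * S ^ 2 = S * (D * g) := by
      rw [← hk, ← hD]; ring
    have : S * (D * g) ≤ S * 1 := mul_le_mul_of_nonneg_left hDg hS
    linarith
  have kS0 : 0 ≤ k * S ^ 2 := by positivity
  have kQ0 : 0 ≤ k * Q := by positivity
  have hhS : 0 ≤ h * S := by positivity
  have e1 : e ≤ 1 := by nlinarith
  have hθ0 : 0 ≤ 1 - (1 - h) * e := by nlinarith
  have hθ1 : 1 - (1 - h) * e ≤ 2 * h := by
    have : 1 - e = e * (h * S) := by linarith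
    have h3 : e * (h * S) ≤ 1 * (h * S) := mul_le_mul_of_nonneg_right e1 hhS
    have h4 : h * S ≤ h := by nlinarith
    nlinarith
  have m1 : 0 ≤ (1 - (1 - h) * e) * (k * Q) := mul_nonneg hθ0 kQ0
  have m2 : (1 - (1 - h) * e) * (k * S ^ 2) ≤ 2 * h := by
    calc (1 - (1 - h) * e) * (k * S ^ 2) ≤ (1 - (1 - h) * e) * 1 :=
          mul_le_mul_of_nonneg_left kS hθ0
      _ ≤ 2 * h := by linarith
  have hA' := mul_le_mul_of_nonneg_left hA h0.le
  have hB' := mul_le_mul_of_nonneg_left hB (by linarith : (0:ℝ) ≤ 1 - h)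
  have main : 0 ≤ h * ((wu - f * wu - f * S - g * S + k * S ^ 2)
      + (1 - (1 - h) * e) * (k * Q) - (1 - (1 - h) * e) * (k * S ^ 2) + 2 * h) :=
    mul_nonneg h0.le (by linarith)
  rw [← hk] at main
  nlinarith

section graph
set_option linter.unusedSectionVars false
variable {V : Type} [Fintype V] [DecidableEq V] (G : SimpleGraph V) [DecidableRel G.Adj]

/-- Weights after picking the vertex `v`. -/
def delW (w : V → ℝ) (v x : V) : ℝ := if x = v ∨ G.Adj v x then 0 else w x

/-- Weight of the common neighbours. -/
def comW (w : V → ℝ) (u v : V) : ℝ := ∑ x, if G.Adj u x ∧ G.Adj v x then w x else 0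

lemma hull_nonneg {w q : V → ℝ} (hq : q ∈ convexHull ℝ (indVec G w)) (u : V) : 0 ≤ q u := by
  have : convexHull ℝ (indVec G w) ⊆ Set.Ici 0 := by
    apply convexHull_min _ (convex_Ici _)
    rintro q ⟨I, -, -, rfl⟩
    intro v
    dsimp
    split_ifs <;> norm_num
  exact this hq u

lemma hull_congr {w w' : V → ℝ} (h : ∀ v, w v ≠ 0 → w' v ≠ 0) :
    convexHull ℝ (indVec G w) ⊆ convexHull ℝ (indVec G w') := by
  apply convexHull_mono
  rintro q ⟨I, h1, h2, rfl⟩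
  exact ⟨I, h1, fun v hv => h v (h2 v hv), rfl⟩

lemma hull_add {w q : V → ℝ} {v : V} (hv : w v ≠ 0)
    (hq : q ∈ convexHull ℝ (indVec G (delW G w v))) :
    q + Pi.single v 1 ∈ convexHull ℝ (indVec G w) := by
  have : convexHull ℝ (indVec G (delW G w v)) ⊆
      (fun z => z + Pi.single v (1:ℝ)) ⁻¹' (convexHull ℝ (indVec G w)) := by
    apply convexHull_min
    · rintro q ⟨I, h1, h2, rfl⟩
      have h2' : ∀ x ∈ I, x ≠ v ∧ ¬ G.Adj v x ∧ w x ≠ 0 := by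
        intro x hx
        have := h2 x hx
        unfold delW at this
        grind
      apply subset_convexHull
      refine ⟨insert v I, ?_, ?_, ?_⟩
      · intro a ha b hb
        rw [Finset.mem_insert] at ha hb
        rcases ha with rfl | ha <;> rcases hb with rfl | hb
        · exact G.loopless.irrefl _
        · exact (h2' b hb).2.1
        · exact fun h => (h2' a ha).2.1 h.symm
        · exact h1 a ha b hb
      · intro x hx
        rw [Finset.mem_insert] at hx
        rcases hx with rfl | hx
        · exact hv
        · exact (h2' x hx).2.2
      · funext x
        by_cases hx : x = v
        · subst hx
          have : x ∉ I := fun h => (h2' x h).1 rfl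
          simp [this]
        · simp [hx]
    · exact (convex_convexHull ℝ _).translate_preimage_left _
  exact this hq

lemma nbS_nonneg {w : V → ℝ} (hw : ∀ v, 0 ≤ w v) (u : V) : 0 ≤ nbS G w u := by
  apply Finset.sum_nonneg
  intro x _
  split_ifs
  · exact hw x
  · exact le_rfl

lemma step_lemma (hG : G.CliqueFree 3) {w : V → ℝ} (hw : ∀ v, 0 ≤ w v) (hw1 : ∑ v, w v = 1)
    {h c η : ℝ} (h0 : 0 < h) (h1 : h < 1) (hη : 0 ≤ η)
    (H1 : ShGood G (fun v => w v * (1 + h * nbS G w v)) c)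
    (H2 : ∀ v, 0 < w v → ShGood G (delW G w v) η) :
    ShGood G w ((1 - h) * c + h * η + 2 * h ^ 2) := by
  have hSn := nbS_nonneg G hw
  have hpos : ∀ v, 0 < 1 + h * nbS G w v := fun v => by
    have := mul_nonneg h0.le (hSn v)
    linarith
  obtain ⟨q', hq', hq'u⟩ := H1
  replace hq' := hull_congr G (w' := w) (fun v hv => left_ne_zero_of_mul hv) hq'
  have key : ∀ v, ∃ r ∈ convexHull ℝ (indVec G w), 0 < w v → ∀ u, 0 < w u →
      shF (nbS G w u / w u) - η + shG (nbS G w u / w u) / w u * comW G w u v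
      - (if u = v then shF (nbS G w u / w u) + shG (nbS G w u / w u) / w u * nbS G w u - 1 else 0)
      - (if G.Adj u v then shF (nbS G w u / w u) else 0) ≤ r u := by
    intro v
    by_cases hv : 0 < w v
    swap
    · exact ⟨q', hq', fun h => absurd h hv⟩
    obtain ⟨q, hq, hqu⟩ := H2 v hv
    refine ⟨_, hull_add G hv.ne' hq, fun _ u hu => ?_⟩
    have hqn := hull_nonneg G hq u
    by_cases huv : u = v
    · subst huv
      have : comW G w u u = nbS G w u := by simp [comW, nbS]
      simp [this]
      linarith
    by_cases hadj : G.Adj u v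
    · have : comW G w u v = 0 := by
        apply Finset.sum_eq_zero
        intro x _
        rw [if_neg]
        rintro ⟨ha, hb⟩
        exact hG {u, v, x} (SimpleGraph.is3Clique_triple_iff.2 ⟨hadj, ha, hb⟩)
      simp [this, huv, hadj]
      linarith
    have hdu : delW G w v u = w u := by
      simp [delW, huv, G.adj_comm v u, hadj]
    have hS : nbS G (delW G w v) u = nbS G w u - comW G w u v := by
      unfold nbS comW
      rw [← Finset.sum_sub_distrib]
      apply Finset.sum_congr rfl
      intro x _
      unfold delW
      grind
    have hdn : 0 ≤ nbS G (delW G w v) u := by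
      apply nbS_nonneg
      intro x
      unfold delW
      split_ifs
      · exact le_rfl
      · exact hw x
    have h3 := hqu u (by rwa [hdu])
    rw [hdu] at h3
    have h4 := shF_tangent (div_nonneg (hSn u) hu.le) (div_nonneg hdn hu.le)
    simp [huv, hadj]
    rw [hS] at h3 h4
    have e : shG (nbS G w u / w u) * ((nbS G w u - comW G w u v) / w u - nbS G w u / w u) =
      - (shG (nbS G w u / w u) / w u * comW G w u v) := by
      field_simp
      ring
    linarith
  choose r hr hru using key
  refine ⟨h • (∑ v, w v • r v) + (1 - h) • q', ?_, ?_⟩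
  · refine (convex_convexHull ℝ _) ?_ hq' h0.le (by linarith) (by ring)
    exact (convex_convexHull ℝ _).sum_mem (fun v _ => hw v) hw1 (fun v _ => hr v)
  intro u hu
  have hD0 : 0 ≤ nbS G w u / w u := div_nonneg (hSn u) hu.le
  have hS1 : nbS G w u ≤ 1 := by
    rw [← hw1]
    apply Finset.sum_le_sum
    intro x _
    split_ifs
    · exact le_rfl
    · exact hw x
  set Q := ∑ x, (if G.Adj u x then w x * nbS G w x else 0) with hQ
  have hQ0 : 0 ≤ Q := by
    apply Finset.sum_nonneg
    intro x _
    split_ifs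
    · exact mul_nonneg (hw x) (hSn x)
    · exact le_rfl
  have hC : ∑ v, w v * comW G w u v = Q := by
    simp only [comW, hQ, nbS, Finset.mul_sum]
    rw [Finset.sum_comm]
    apply Finset.sum_congr rfl
    intro x _
    by_cases hx : G.Adj u x
    · simp only [hx, true_and, if_true]
      apply Finset.sum_congr rfl
      intro y _
      by_cases hy : G.Adj x y
      · simp [hy, hy.symm, mul_comm]
      · simp [hy, G.adj_comm y x]
    · simp [hx]
  have goal_eq : (h • (∑ v, w v • r v) + (1 - h) • q') u =
      h * (∑ v, w v * r v u) + (1 - h) * q' u := by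
    simp [Finset.sum_apply]
  rw [goal_eq]
  set f := shF (nbS G w u / w u) with hf
  set g := shG (nbS G w u / w u) with hg
  have hg0 : 0 ≤ g := shG_nonneg hD0
  apply step_arith f g (g / w u) (w u) (nbS G w u) Q h c η _ _ (nbS G w u / w u)
    (1 + h * nbS G w u)⁻¹ (by field_simp) (by positivity) hu (hSn u) hS1 hQ0 h0 h1
    (by field_simp) (mul_shG_le_one hD0) (inv_mul_cancel₀ (hpos u).ne')
    (inv_nonneg.2 (hpos u).le) (shF_ode hD0)
  · have : ∑ v, w v * (f - η + g / w u * comW G w u v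
      - (if u = v then f + g / w u * nbS G w u - 1 else 0)
      - (if G.Adj u v then f else 0)) = 
      f - η + g / w u * Q - w u * (f + g / w u * nbS G w u - 1) - nbS G w u * f := by
      simp only [mul_sub, mul_add, Finset.sum_sub_distrib, Finset.sum_add_distrib]
      have e1 : ∑ v, w v * f = f := by rw [← Finset.sum_mul, hw1, one_mul]
      have e2 : ∑ v, w v * η = η := by rw [← Finset.sum_mul, hw1, one_mul]
      have e3 : ∑ v, w v * (g / w u * comW G w u v) = g / w u * Q := by
        rw [← hC, Finset.mul_sum]
        exact Finset.sum_congr rfl fun x _ => by ring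
      have e4 : ∑ v, w v * (if u = v then f + g / w u * nbS G w u - 1 else 0) =
        w u * (f + g / w u * nbS G w u - 1) := by simp
      have e5 : ∑ v, w v * (if G.Adj u v then f else 0) = nbS G w u * f := by
        simp only [nbS, Finset.sum_mul]
        exact Finset.sum_congr rfl fun x _ => by split_ifs <;> simp
      rw [e1, e2, e3, e4, e5]
      ring
    rw [← this]
    apply Finset.sum_le_sum
    intro v _
    rcases (hw v).eq_or_lt with h | h
    · simp [← h]
    · exact mul_le_mul_of_nonneg_left (hru v h u hu) h.le
  · have h3 := hq'u u (mul_pos hu (hpos u))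
    set w' : V → ℝ := fun v => w v * (1 + h * nbS G w v) with hw'
    have hw'0 : ∀ v, 0 ≤ w' v := fun v => mul_nonneg (hw v) (hpos v).le
    have h4 := shF_tangent hD0 (div_nonneg (nbS_nonneg G hw'0 u) (hw'0 u))
    have hS' : nbS G w' u = nbS G w u + h * Q := by
      have e1 : nbS G w' u = ∑ x, if G.Adj u x then w x * (1 + h * nbS G w x) else 0 := rfl
      have e2 : nbS G w u = ∑ x, if G.Adj u x then w x else 0 := rfl
      rw [e1, e2, hQ, Finset.mul_sum, ← Finset.sum_add_distrib]
      exact Finset.sum_congr rfl fun x _ => by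
        split_ifs
        · ring
        · simp
    have hd : g * (nbS G w' u / w' u - nbS G w u / w u) =
        g / w u * (1 + h * nbS G w u)⁻¹ * h * (Q - nbS G w u ^ 2) := by
      have hp := (hpos u).ne'
      rw [hS']
      simp only [hw']
      generalize nbS G w u = S at *
      obtain ⟨s, hs⟩ : ∃ s, s = 1 + h * S := ⟨_, rfl⟩
      rw [← hs] at hp ⊢
      field_simp
      subst hs
      ring
    have h3' : shF (nbS G w' u / w' u) - c ≤ q' u := h3
    rw [← hf, ← hg] at h4
    linarith

lemma ShGood.mono {w : V → ℝ} {c c' : ℝ} (h : ShGood G w c) (hc : c ≤ c') : ShGood G w c' := by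
  obtain ⟨q, hq, hu⟩ := h
  exact ⟨q, hq, fun u hw => by linarith [hu u hw]⟩

lemma zero_mem_hull (w : V → ℝ) : (0 : V → ℝ) ∈ convexHull ℝ (indVec G w) := by
  apply subset_convexHull
  refine ⟨∅, ?_, ?_, ?_⟩
  · intro u hu
    simp at hu
  · intro u hu
    simp at hu
  · funext u
    simp

lemma shGood_one {w : V → ℝ} (hw : ∀ v, 0 ≤ w v) : ShGood G w 1 := by
  refine ⟨0, zero_mem_hull G w, fun u hu => ?_⟩
  have := shF_le_one_s2 (div_nonneg (nbS_nonneg G hw u) hu.le)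
  simp
  linarith

lemma shGood_zero {w : V → ℝ} (hw : ∀ v, w v = 0) (c : ℝ) : ShGood G w c :=
  ⟨0, zero_mem_hull G w, fun u hu => absurd (hw u) hu.ne'⟩

lemma ShGood.scale {w : V → ℝ} {W c : ℝ} (hW : 0 < W) (h : ShGood G (fun v => w v / W) c) :
    ShGood G w c := by
  obtain ⟨q, hq, hu⟩ := h
  refine ⟨q, hull_congr G (fun v hv h0 => hv (by simp [h0])) hq, fun u hwu => ?_⟩
  have h1 := hu u (div_pos hwu hW)
  have h2 : nbS G (fun v => w v / W) u = nbS G w u / W := by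
    unfold nbS
    rw [Finset.sum_div]
    exact Finset.sum_congr rfl fun x _ => by split_ifs <;> simp
  rw [h2] at h1
  have h3 : nbS G w u / W / (w u / W) = nbS G w u / w u := by
    field_simp
  simp only [h3] at h1
  exact h1

lemma shGood_all (hG : G.CliqueFree 3) (n : ℕ) : ∀ η : ℝ, 0 < η → ∀ w : V → ℝ, (∀ v, 0 ≤ w v) →
    (Finset.univ.filter (fun v => w v ≠ 0)).card ≤ n → ShGood G w η := by
  induction n with
  | zero =>
    intro η hη w hw hn
    apply shGood_zero
    intro v
    by_contra hv
    have : v ∈ Finset.univ.filter (fun v => w v ≠ 0) := by simp [hv]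
    rw [Finset.card_eq_zero.1 (Nat.le_zero.1 hn)] at this
    simp at this
  | succ n ih =>
    have inner : ∀ h : ℝ, 0 < h → h < 1 → ∀ k : ℕ, ∀ w : V → ℝ, (∀ v, 0 ≤ w v) →
        (Finset.univ.filter (fun v => w v ≠ 0)).card ≤ n + 1 →
        ShGood G w ((1 - h) ^ k + 3 * h) := by
      intro h h0 h1 k
      induction k with
      | zero =>
        intro w hw _
        exact (shGood_one G hw).mono G (by simp; linarith)
      | succ k ihk =>
        intro w hw hn
        have hWn : 0 ≤ ∑ v, w v := Finset.sum_nonneg fun v _ => hw v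
        rcases hWn.eq_or_lt with hW | hW
        · apply shGood_zero
          intro v
          exact (Finset.sum_eq_zero_iff_of_nonneg (fun v _ => hw v)).1 hW.symm v (Finset.mem_univ v)
        set W := ∑ v, w v with hWdef
        apply ShGood.scale G hW
        set w1 : V → ℝ := fun v => w v / W with hw1
        have hw1n : ∀ v, 0 ≤ w1 v := fun v => div_nonneg (hw v) hW.le
        have hsum : ∑ v, w1 v = 1 := by
          rw [hw1, ← Finset.sum_div]
          exact div_self hW.ne'
        have hsupp : ∀ v, w1 v ≠ 0 → w v ≠ 0 := fun v hv h0 => hv (by simp [hw1, h0])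
        have hc := step_lemma G hG hw1n hsum h0 h1 h0.le (c := (1 - h) ^ k + 3 * h) ?_ ?_
        · refine hc.mono G (le_of_eq ?_)
          ring
        · apply ihk
          · intro v
            have := mul_nonneg h0.le (nbS_nonneg G hw1n v)
            exact mul_nonneg (hw1n v) (by linarith)
          · refine le_trans (Finset.card_le_card ?_) hn
            intro v hv
            simp only [Finset.mem_filter, Finset.mem_univ, true_and] at hv ⊢
            exact hsupp v (left_ne_zero_of_mul hv)
        · intro v hv
          apply ih h h0
          · intro x
            unfold delW
            split_ifs
            · exact le_rfl
            · exact hw1n x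
          · apply Nat.le_of_lt_succ
            refine lt_of_lt_of_le (Finset.card_lt_card ?_) hn
            rw [Finset.ssubset_iff_of_subset]
            · refine ⟨v, ?_, ?_⟩
              · simpa using hsupp v hv.ne'
              · simp [delW]
            · intro x hx
              simp only [Finset.mem_filter, Finset.mem_univ, true_and] at hx ⊢
              apply hsupp
              intro h0
              apply hx
              simp [delW, h0]
    intro η hη w hw hn
    set h := min (1/2) (η / 6) with hh
    have h0 : 0 < h := lt_min (by norm_num) (by linarith)
    have h1 : h < 1 := lt_of_le_of_lt (min_le_left _ _) (by norm_num)
    have h2 : h ≤ η / 6 := min_le_right _ _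
    obtain ⟨k, hk⟩ := exists_pow_lt_of_lt_one (half_pos hη) (by linarith : 1 - h < 1)
    exact (inner h h0 h1 k w hw hn).mono G (by linarith)

lemma hull_to_dist {w q : V → ℝ} (hq : q ∈ convexHull ℝ (indVec G w)) :
    ∃ p : Finset V → ℝ, (∀ I, 0 ≤ p I) ∧ (∀ I, p I ≠ 0 → IsIndepFinset G I) ∧
      (∑ I : Finset V, p I) = 1 ∧
      ∀ v, q v = ∑ I ∈ Finset.univ.filter (fun I : Finset V => v ∈ I), p I := by
  have : convexHull ℝ (indVec G w) ⊆ {q | ∃ p : Finset V → ℝ, (∀ I, 0 ≤ p I) ∧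
      (∀ I, p I ≠ 0 → IsIndepFinset G I) ∧ (∑ I : Finset V, p I) = 1 ∧
      ∀ v, q v = ∑ I ∈ Finset.univ.filter (fun I : Finset V => v ∈ I), p I} := by
    apply convexHull_min
    · rintro q ⟨I, h1, -, rfl⟩
      refine ⟨Pi.single I 1, ?_, ?_, ?_, ?_⟩
      · intro J
        by_cases hJ : J = I
        · subst hJ; simp
        · simp [hJ]
      · intro J hJ
        by_cases hJI : J = I
        · exact hJI ▸ h1
        · simp [hJI] at hJ
      · simp
      · intro v
        rw [Finset.sum_filter]
        rw [Finset.sum_eq_single I]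
        · simp
        · intro J _ hJ
          simp [hJ]
        · simp
    · rintro q ⟨p, h1, h2, h3, h4⟩ q' ⟨p', h1', h2', h3', h4'⟩ a b ha hb hab
      refine ⟨fun I => a * p I + b * p' I, ?_, ?_, ?_, ?_⟩
      · intro I
        have := h1 I
        have := h1' I
        positivity
      · intro I hI
        by_cases hp : p I = 0
        · by_cases hp' : p' I = 0
          · simp [hp, hp'] at hI
          · exact h2' I hp'
        · exact h2 I hp
      · rw [Finset.sum_add_distrib, ← Finset.mul_sum, ← Finset.mul_sum, h3, h3']
        linarith
      · intro v
        rw [Finset.sum_add_distrib, ← Finset.mul_sum, ← Finset.mul_sum, ← h4, ← h4']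
        simp
  exact this hq

end graph

/-- for every `ε ∈ (0,1)` there is `D ≥ 2` such that every finite
triangle-free graph has a probability distribution on its independent sets covering
every vertex `v` of degree at least `D` with probability at least
`(1-ε)·ln(d_G(v))/d_G(v)`. -/
theorem local_shearer_asymptotic (ε : ℝ) (hε : 0 < ε) (hε1 : ε < 1) :
    ∃ D : ℕ, 2 ≤ D ∧
      ∀ (V : Type) [Fintype V] [DecidableEq V] (G : SimpleGraph V)
        [DecidableRel G.Adj], G.CliqueFree 3 →
        ∃ p : Finset V → ℝ,
          (∀ I, 0 ≤ p I) ∧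
          (∀ I, p I ≠ 0 → IsIndepFinset G I) ∧
          (∑ I : Finset V, p I) = 1 ∧
          ∀ v : V, D ≤ G.degree v →
            (1 - ε) * Real.log (G.degree v) / (G.degree v) ≤
              ∑ I ∈ Finset.univ.filter (fun I : Finset V => v ∈ I), p I := by
  obtain ⟨D, hD⟩ := exists_nat_ge (Real.exp (6 / ε))
  refine ⟨max D 3, le_trans (by norm_num) (le_max_right _ _), ?_⟩
  intro V _ _ G _ hG
  have hη : 0 < ε / 2 / (Fintype.card V + 1) := by positivity
  obtain ⟨q, hq, hqu⟩ := shGood_all G hG _ _ hη (fun _ => 1) (fun _ => zero_le_one) le_rfl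
  obtain ⟨p, h1, h2, h3, h4⟩ := hull_to_dist G hq
  refine ⟨p, h1, h2, h3, fun v hv => ?_⟩
  rw [← h4]
  have h5 := hqu v one_pos
  have h6 : nbS G (fun _ => 1) v = G.degree v := by
    simp [nbS, SimpleGraph.degree, SimpleGraph.neighborFinset_eq_filter]
  rw [h6, div_one] at h5
  refine le_trans ?_ h5
  have hdn : 3 ≤ G.degree v := le_trans (le_max_right _ _) hv
  have hd3 : (3:ℝ) ≤ G.degree v := by exact_mod_cast hdn
  have hdD : (D:ℝ) ≤ G.degree v := by exact_mod_cast le_trans (le_max_left _ _) hv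
  have hcard : (G.degree v : ℝ) ≤ Fintype.card V + 1 := by
    have := G.degree_lt_card_verts v
    exact_mod_cast (by omega : G.degree v ≤ Fintype.card V + 1)
  generalize (G.degree v : ℝ) = d at *
  have hd0 : 0 < d := by linarith
  have hlog : 6 / ε ≤ Real.log d := by
    rw [Real.le_log_iff_exp_le hd0]
    linarith
  have hlog' : 6 ≤ Real.log d * ε := by rwa [div_le_iff₀ hε] at hlog
  have h7 := shF_lower (by linarith : 1 ≤ d)
  have h8 : ε / 2 / (Fintype.card V + 1) ≤ ε / 2 / d :=
    div_le_div_of_nonneg_left (by linarith) hd0 hcard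
  have h9 : (1 - ε) * Real.log d / d + ε / 2 / d ≤ (Real.log d - 2) / d := by
    rw [← add_div]
    apply div_le_div_of_nonneg_right _ hd0.le
    linarith
  linarith
end

section
/- For every δ > 0 there exists a natural number n₁ such that every finite triangle-free simple graph G on n ≥ n₁ vertices admits a probability distribution p on its independent sets under which every vertex of G is covered with probability at least (1/(√2 + δ))·√(ln n / n); equivalently, the fractional chromatic number of every triangle-free graph on n vertices is at most (√2 + o(1))·√(n/ln n) as n → ∞. -/
open Finset

namespace TriFree

open Classical in
/-- Real-valued adjacency indicator. -/
noncomputable def aw {V : Type*} (G : SimpleGraph V) (u v : V) : ℝ := if G.Adj u v then 1 else 0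

/-- Total weight around `v`, plus the artificial killing rate `e`. -/
noncomputable def S {V : Type*} [Fintype V] (G : SimpleGraph V) (e : ℝ) (w : V → ℝ) (v : V) : ℝ :=
  e + ∑ u, aw G v u * w u

noncomputable def phi (L x : ℝ) : ℝ := x * (L - Real.log x)

/-- The potential of the vertex `v` in the state `w`. -/
noncomputable def f {V : Type*} [Fintype V] (G : SimpleGraph V) (L e : ℝ) (w : V → ℝ) (v : V) : ℝ :=
  phi L (w v) / S G e w v

open Classical in
noncomputable def k1 {V : Type*} (w : V → ℝ) (x : V) : V → ℝ := fun u => if u = x then 0 else w u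

open Classical in
noncomputable def k2 {V : Type*} (G : SimpleGraph V) (w : V → ℝ) (x : V) : V → ℝ :=
  fun u => if u = x ∨ G.Adj x u then 0 else w u

lemma aw_nonneg {V : Type*} (G : SimpleGraph V) (u v : V) : 0 ≤ aw G u v := by
  unfold aw; split_ifs <;> norm_num

lemma aw_comm {V : Type*} (G : SimpleGraph V) (u v : V) : aw G u v = aw G v u := by
  unfold aw; congr 1; exact propext (G.adj_comm u v)

lemma phi_zero (L : ℝ) : phi L 0 = 0 := by simp [phi]

lemma phi_nonneg {L x : ℝ} (h0 : 0 ≤ x) (h1 : x ≤ Real.exp L) : 0 ≤ phi L x := by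
  rcases h0.eq_or_lt with h | h
  · rw [← h, phi_zero]
  · unfold phi
    have := (Real.log_le_iff_le_exp h).2 h1
    exact mul_nonneg h0 (by linarith)

lemma phi_le {L x : ℝ} (h0 : 0 ≤ x) : phi L x ≤ Real.exp L := by
  rcases h0.eq_or_lt with h | h
  · rw [← h, phi_zero]; positivity
  · unfold phi
    have h2 := Real.add_one_le_exp (L - Real.log x)
    rw [Real.exp_sub, Real.exp_log h] at h2
    have : x * (L - Real.log x + 1) ≤ x * (Real.exp L / x) := mul_le_mul_of_nonneg_left h2 h0
    rw [mul_div_cancel₀ _ h.ne'] at this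
    nlinarith

lemma S_pos {V : Type*} [Fintype V] (G : SimpleGraph V) {e : ℝ} (_ : 0 < e) {w : V → ℝ}
    (hw : ∀ u, 0 ≤ w u) (v : V) : e ≤ S G e w v := by
  have : 0 ≤ ∑ u, aw G v u * w u := Finset.sum_nonneg fun u _ => mul_nonneg (aw_nonneg G v u) (hw u)
  unfold S; linarith

lemma conv_aux {p s m : ℝ} (hp : 0 ≤ p) (hs : 0 < s) (hm : 0 < s - m) :
    p / s ^ 2 * m ≤ p / (s - m) - p / s := by
  have : p / (s - m) - p / s - p / s ^ 2 * m = p * m ^ 2 / (s ^ 2 * (s - m)) := by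
    field_simp
    ring
  have h2 : 0 ≤ p * m ^ 2 / (s ^ 2 * (s - m)) := by positivity
  linarith

lemma k1_nonneg {V : Type*} {w : V → ℝ} (hw : ∀ u, 0 ≤ w u) (x u : V) : 0 ≤ k1 w x u := by
  unfold k1; split_ifs; exacts [le_rfl, hw u]

lemma k2_nonneg {V : Type*} (G : SimpleGraph V) {w : V → ℝ} (hw : ∀ u, 0 ≤ w u) (x u : V) :
    0 ≤ k2 G w x u := by
  unfold k2; split_ifs; exacts [le_rfl, hw u]

open Classical in
lemma step1 {V : Type*} [Fintype V] (G : SimpleGraph V) {L e : ℝ} (he : 0 < e) {w : V → ℝ}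
    (hw : ∀ u, 0 ≤ w u) (v : V) (hp : 0 ≤ phi L (w v)) (x : V) :
    - f G L e w v * (if x = v then 1 else 0) + phi L (w v) / (S G e w v) ^ 2 * (aw G v x * w x)
      ≤ f G L e (k1 w x) v - f G L e w v := by
  by_cases hx : x = v
  · subst hx
    simp [f, k1, phi_zero, aw]
  · have hS : S G e (k1 w x) v = S G e w v - aw G v x * w x := by
      unfold S k1
      have : ∀ u, aw G v u * (if u = x then 0 else w u)
          = aw G v u * w u - (if u = x then aw G v x * w x else 0) := by
        intro u; split_ifs with h
        · subst h; ring
        · ring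
      simp only [this, Finset.sum_sub_distrib]
      simp
      ring
    have h1 := S_pos G he hw v
    have h2 := S_pos G he (k1_nonneg hw x) v
    rw [hS] at h2
    have hv : k1 w x v = w v := by simp [k1, Ne.symm hx]
    simp only [f, hS, hv, hx, if_false]
    have := conv_aux hp (by linarith) (lt_of_lt_of_le he h2)
    linarith

open Classical in
lemma step2 {V : Type*} [Fintype V] (G : SimpleGraph V) (hG : G.CliqueFree 3)
    {L e : ℝ} (he : 0 < e) {w : V → ℝ}
    (hw : ∀ u, 0 ≤ w u) (v : V) (hp : 0 ≤ phi L (w v)) (x : V) :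
    - f G L e w v * (if x = v then 1 else 0) - f G L e w v * aw G v x
      + phi L (w v) / (S G e w v) ^ 2 *
        (∑ u, aw G v u * aw G u x * w u - (if x = v then S G e w v - e else 0))
      ≤ f G L e (k2 G w x) v - f G L e w v := by
  have htri : ∀ u, G.Adj v x → G.Adj v u → G.Adj u x → False := by
    intro u h1 h2 h3
    exact hG {v, u, x} (SimpleGraph.is3Clique_triple_iff.2 ⟨h2, h1, h3⟩)
  by_cases hx : x = v
  · subst hx
    have h1 : f G L e (k2 G w x) x = 0 := by simp [f, k2, phi_zero]
    have h2 : ∑ u, aw G x u * aw G u x * w u = S G e w x - e := by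
      unfold S
      rw [add_sub_cancel_left]
      refine Finset.sum_congr rfl fun u _ => ?_
      rw [aw_comm G u x]
      unfold aw; split_ifs <;> simp
    rw [h1, h2]
    simp [aw]
  · by_cases ha : G.Adj v x
    · have h1 : f G L e (k2 G w x) v = 0 := by simp [f, k2, phi_zero, ha.symm]
      have h2 : ∑ u, aw G v u * aw G u x * w u = 0 := by
        refine Finset.sum_eq_zero fun u _ => ?_
        unfold aw
        split_ifs with h3 h4
        · exact (htri u ha h3 h4).elim
        all_goals simp
      rw [h1, h2]
      simp [hx, aw, ha]
    · have hS : S G e (k2 G w x) v = S G e w v - ∑ u, aw G v u * aw G u x * w u := by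
        unfold S
        rw [add_sub_assoc, ← Finset.sum_sub_distrib]
        congr 1
        refine Finset.sum_congr rfl fun u _ => ?_
        unfold k2
        rw [aw_comm G u x]
        by_cases hux : u = x
        · subst hux; simp [aw, ha]
        · by_cases hh : G.Adj x u <;> simp [aw, hh, hux]
      have h1 := S_pos G he hw v
      have h2 := S_pos G he (k2_nonneg G hw x) v
      rw [hS] at h2
      have hv : k2 G w x v = w v := by
        have : ¬ G.Adj x v := fun h => ha h.symm
        simp [k2, Ne.symm hx, this]
      simp only [f, hS, hv, hx, if_false]
      have := conv_aux hp (by linarith) (lt_of_lt_of_le he h2)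
      have h3 : aw G v x = 0 := by simp [aw, ha]
      rw [h3]
      linarith

/-- The generator inequality. -/
lemma gen {V : Type*} [Fintype V] (G : SimpleGraph V) (hG : G.CliqueFree 3)
    {L e : ℝ} (he : 0 < e) {w : V → ℝ}
    (hw : ∀ u, 0 ≤ w u) (hT : ∀ u, w u ≤ Real.exp L) (v : V) :
    - w v * (1 + 2 * Real.exp L / e) ≤
     phi L (w v) - w v - phi L (w v) / (S G e w v) ^ 2 * ∑ u, aw G v u * (w u * S G e w u)
      + ∑ x, w x * (f G L e (k2 G w x) v - f G L e w v)
      + ∑ x, e * (f G L e (k1 w x) v - f G L e w v) := by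
  classical
  have hp := phi_nonneg (hw v) (hT v)
  have hSe := S_pos G he hw v
  have hS0 : 0 < S G e w v := by linarith
  set φ := phi L (w v) with hφ
  set s := S G e w v with hs
  have hfs : f G L e w v * s = φ := by unfold f; rw [← hs, ← hφ]; field_simp
  have hsum : ∑ u, aw G v u * w u = s - e := by rw [hs]; unfold S; ring
  have A1 : ∑ x, e * (-f G L e w v * (if x = v then 1 else 0) + φ / s ^ 2 * (aw G v x * w x))
      = - e * f G L e w v + φ / s ^ 2 * (e * (s - e)) := by
    rw [← Finset.mul_sum, Finset.sum_add_distrib, ← Finset.mul_sum, ← Finset.mul_sum, hsum]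
    simp
    ring
  have B1 := Finset.sum_le_sum fun x (_ : x ∈ Finset.univ) =>
    mul_le_mul_of_nonneg_left (step1 G he hw v hp x) he.le
  rw [A1] at B1
  have A2 : ∑ x, w x * (- f G L e w v * (if x = v then 1 else 0) - f G L e w v * aw G v x
      + φ / s ^ 2 * (∑ u, aw G v u * aw G u x * w u - (if x = v then s - e else 0)))
      = - f G L e w v * w v - f G L e w v * (s - e) + φ / s ^ 2 *
        (∑ u, aw G v u * (w u * S G e w u) - e * (s - e) - w v * (s - e)) := by
    have C1 : ∀ x, w x * (- f G L e w v * (if x = v then 1 else 0) - f G L e w v * aw G v x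
      + φ / s ^ 2 * (∑ u, aw G v u * aw G u x * w u - (if x = v then s - e else 0)))
      = (- f G L e w v) * (if x = v then w x else 0) - f G L e w v * (aw G v x * w x)
        + φ / s ^ 2 * (∑ u, aw G v u * aw G u x * w u * w x)
        - φ / s ^ 2 * (if x = v then w x * (s - e) else 0) := by
      intro x
      rw [← Finset.sum_mul]
      split_ifs <;> ring
    simp only [C1, Finset.sum_add_distrib, Finset.sum_sub_distrib, ← Finset.mul_sum]
    rw [hsum, Finset.sum_comm]
    have C2 : ∑ u, ∑ x, aw G v u * aw G u x * w u * w x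
        = ∑ u, aw G v u * (w u * S G e w u) - e * (s - e) := by
      rw [← hsum, Finset.mul_sum, ← Finset.sum_sub_distrib]
      refine Finset.sum_congr rfl fun u _ => ?_
      unfold S
      have : ∑ x, aw G v u * aw G u x * w u * w x = aw G v u * w u * ∑ x, aw G u x * w x := by
        rw [Finset.mul_sum]
        exact Finset.sum_congr rfl fun x _ => by ring
      rw [this]; ring
    rw [C2]
    simp
    ring
  have B2 := Finset.sum_le_sum fun x (_ : x ∈ Finset.univ) =>
    mul_le_mul_of_nonneg_left (step2 G hG he hw v hp x) (hw x)
  rw [A2] at B2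
  have D1 : φ / s ≤ Real.exp L / e := div_le_div₀ (Real.exp_pos L).le (phi_le (hw v)) he hSe
  have D2 : φ / s ^ 2 * (s - e) ≤ φ / s := by
    rw [div_mul_eq_mul_div, div_le_div_iff₀ (by positivity) hS0]
    have : 0 ≤ φ * e * s := by positivity
    nlinarith
  have hf : f G L e w v = φ / s := rfl
  rw [← hf] at D1 D2
  have D3 := mul_le_mul_of_nonneg_left D1 (hw v)
  have D4 := mul_le_mul_of_nonneg_left D2 (hw v)
  have E : - w v * (1 + 2 * Real.exp L / e) = - w v - 2 * (w v * (Real.exp L / e)) := by ring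
  rw [E]
  linarith

end TriFree

namespace TriFree

lemma phi_exp (L : ℝ) : phi L (Real.exp L) = 0 := by simp [phi]

lemma S_mono {V : Type*} [Fintype V] (G : SimpleGraph V) (e : ℝ) {w w' : V → ℝ}
    (h : ∀ u, w u ≤ w' u) (v : V) : S G e w v ≤ S G e w' v := by
  unfold S
  have := Finset.sum_le_sum fun u (_ : u ∈ Finset.univ) =>
    mul_le_mul_of_nonneg_left (h u) (aw_nonneg G v u)
  linarith

lemma continuous_phi (L : ℝ) : Continuous (phi L) := by
  have : phi L = fun x => x * L - x * Real.log x := by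
    funext x; unfold phi; ring
  rw [this]
  exact (continuous_id.mul continuous_const).sub Real.continuous_mul_log

lemma deriv_f {V : Type*} [Fintype V] (G : SimpleGraph V) {L e : ℝ} (he : 0 < e) {w : V → ℝ}
    (hw : ∀ u, 0 ≤ w u) (v : V) :
    HasDerivAt (fun t : ℝ => f G L e (fun u => w u + t * (w u * S G e w u)) v)
      (phi L (w v) - w v - phi L (w v) / (S G e w v) ^ 2 * ∑ u, aw G v u * (w u * S G e w u)) 0 := by
  have hSe := S_pos G he hw v
  have hS0 : S G e w v ≠ 0 := by linarith
  rcases (hw v).eq_or_lt with h | h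
  · simp only [f, ← h, phi_zero]
    simpa [phi_zero] using hasDerivAt_const (0:ℝ) (0:ℝ)
  · have hS : HasDerivAt (fun t : ℝ => S G e (fun u => w u + t * (w u * S G e w u)) v)
        (∑ u, aw G v u * (w u * S G e w u)) 0 := by
      have : (fun t : ℝ => S G e (fun u => w u + t * (w u * S G e w u)) v)
          = fun t => S G e w v + t * ∑ u, aw G v u * (w u * S G e w u) := by
        funext t
        unfold S
        rw [Finset.mul_sum, add_assoc, ← Finset.sum_add_distrib]
        congr 1
        exact Finset.sum_congr rfl fun u _ => by ring
      rw [this]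
      simpa using ((hasDerivAt_id (0:ℝ)).mul_const
        (∑ u, aw G v u * (w u * S G e w u))).const_add (S G e w v)
    have hg : HasDerivAt (fun t : ℝ => w v + t * (w v * S G e w v)) (w v * S G e w v) 0 := by
      simpa using ((hasDerivAt_id (0:ℝ)).mul_const (w v * S G e w v)).const_add (w v)
    have hlog := hg.log (by simpa using h.ne')
    have hphi := hg.mul (hlog.const_sub L)
    have := hphi.div hS (by simpa using hS0)
    refine this.congr_deriv ?_
    simp only [zero_mul, add_zero, phi, Pi.mul_apply]
    field_simp
    ring

lemma max_step {V : Type*} [Fintype V] [DecidableEq V] (G : SimpleGraph V) (hG : G.CliqueFree 3)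
    {L e : ℝ} (he : 0 < e) (c : V → ℝ) (hc : ∀ v, 0 ≤ c v) {w : V → ℝ}
    (hw : ∀ u, 0 ≤ w u) (hT : ∀ u, w u ≤ Real.exp L)
    (hmax : IsLocalMax (fun t : ℝ => ∑ v, c v * f G L e (fun u => w u + t * (w u * S G e w u)) v) 0) :
    0 ≤ ∑ x, w x * (c x * (1 + 2 * Real.exp L / e) +
        (∑ v, c v * f G L e (k2 G w x) v) - ∑ v, c v * f G L e w v)
      + ∑ x, e * ((∑ v, c v * f G L e (k1 w x) v) - ∑ v, c v * f G L e w v) := by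
  have hd := HasDerivAt.fun_sum (u := Finset.univ) fun v (_ : v ∈ Finset.univ) =>
    (deriv_f G (L := L) he hw v).const_mul (c v)
  have h0 := hmax.hasDerivAt_eq_zero hd
  have h1 := Finset.sum_le_sum fun v (_ : v ∈ Finset.univ) =>
    mul_le_mul_of_nonneg_left (gen G hG he hw hT v) (hc v)
  simp only [mul_add (c _) _ _, Finset.sum_add_distrib] at h1
  rw [h0] at h1
  have e1 : ∑ v, c v * ∑ x, w x * (f G L e (k2 G w x) v - f G L e w v)
      = ∑ x, w x * ((∑ v, c v * f G L e (k2 G w x) v) - ∑ v, c v * f G L e w v) := by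
    simp only [Finset.mul_sum, ← Finset.sum_sub_distrib]
    rw [Finset.sum_comm]
    exact Finset.sum_congr rfl fun x _ => Finset.sum_congr rfl fun v _ => by ring
  have e2 : ∑ v, c v * ∑ x, e * (f G L e (k1 w x) v - f G L e w v)
      = ∑ x, e * ((∑ v, c v * f G L e (k1 w x) v) - ∑ v, c v * f G L e w v) := by
    simp only [Finset.mul_sum, ← Finset.sum_sub_distrib]
    rw [Finset.sum_comm]
    exact Finset.sum_congr rfl fun x _ => Finset.sum_congr rfl fun v _ => by ring
  rw [e1, e2] at h1
  have e3 : ∑ x, w x * (c x * (1 + 2 * Real.exp L / e) +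
        (∑ v, c v * f G L e (k2 G w x) v) - ∑ v, c v * f G L e w v)
      = ∑ x, w x * ((∑ v, c v * f G L e (k2 G w x) v) - ∑ v, c v * f G L e w v)
        - ∑ v, c v * (-w v * (1 + 2 * Real.exp L / e)) := by
    rw [← Finset.sum_sub_distrib]
    exact Finset.sum_congr rfl fun x _ => by ring
  rw [e3]
  linarith

lemma key {V : Type*} [Fintype V] [DecidableEq V] (G : SimpleGraph V) (hG : G.CliqueFree 3)
    {L e : ℝ} (he : 0 < e) (c : V → ℝ) (hc : ∀ v, 0 ≤ c v) (A : Finset V) :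
    ∀ w : V → ℝ, (∀ u, 0 ≤ w u) → (∀ u, w u ≤ Real.exp L) → (∀ u, u ∉ A → w u = 0) →
    ∃ I : Finset V, I ⊆ A ∧ IsIndepFinset G I ∧
      ∑ v, c v * f G L e w v ≤ (1 + 2 * Real.exp L / e) * ∑ v ∈ I, c v := by
  classical
  induction A using Finset.strongInduction with
  | H A ih =>
  set κ := 1 + 2 * Real.exp L / e with hκ
  let Ψ : (V → ℝ) → ℝ := fun w => ∑ v, c v * f G L e w v
  let K : Set (V → ℝ) := {w | (∀ u, 0 ≤ w u) ∧ (∀ u, w u ≤ Real.exp L) ∧ (∀ u, u ∉ A → w u = 0)}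
  have hKc : IsCompact K := by
    have hcl : IsClosed {w : V → ℝ | ∀ u, u ∉ A → w u = 0} := by
      simp only [Set.ofPred_forall]
      exact isClosed_iInter fun u => isClosed_iInter fun _ =>
        isClosed_eq (continuous_apply u) continuous_const
    have : K = Set.Icc (fun _ => 0) (fun _ => Real.exp L) ∩ {w : V → ℝ | ∀ u, u ∉ A → w u = 0} := by
      ext w; simp only [K, Set.mem_ofPred_eq, Set.mem_inter_iff, Set.mem_Icc, Pi.le_def, and_assoc]
    rw [this]
    exact isCompact_Icc.inter_right hcl
  have hcont : ContinuousOn Ψ K := by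
    refine continuousOn_finsetSum _ fun v _ => continuousOn_const.mul ?_
    refine ContinuousOn.div ?_ ?_ ?_
    · exact ((continuous_phi L).comp (continuous_apply v)).continuousOn
    · unfold S
      exact (continuous_const.add (continuous_finsetSum _ fun u _ =>
        continuous_const.mul (continuous_apply u))).continuousOn
    · intro w hw
      have := S_pos G he hw.1 v
      linarith
  have hKne : K.Nonempty := ⟨0, fun _ => le_rfl, fun _ => (Real.exp_pos L).le, fun _ _ => rfl⟩
  obtain ⟨w, hwK, hwmax⟩ := hKc.exists_isMaxOn hKne hcont
  suffices hs : ∃ I : Finset V, I ⊆ A ∧ IsIndepFinset G I ∧ Ψ w ≤ κ * ∑ v ∈ I, c v by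
    obtain ⟨I, h1, h2, h3⟩ := hs
    intro w' a b d
    exact ⟨I, h1, h2, le_trans (hwmax (show w' ∈ K from ⟨a, b, d⟩)) h3⟩
  obtain ⟨hw, hT, hA⟩ := hwK
  have hk1T : ∀ x u, k1 w x u ≤ Real.exp L := by
    intro x u; unfold k1; split_ifs; exacts [(Real.exp_pos L).le, hT u]
  have hk1A : ∀ x u, u ∉ A.erase x → k1 w x u = 0 := by
    intro x u hu; unfold k1
    split_ifs with h
    · rfl
    · exact hA u fun h' => hu (Finset.mem_erase.2 ⟨h, h'⟩)
  have ih1 : ∀ x ∈ A, ∃ I : Finset V, I ⊆ A ∧ IsIndepFinset G I ∧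
      Ψ (k1 w x) ≤ κ * ∑ v ∈ I, c v := by
    intro x hx
    obtain ⟨I, h1, h2, h3⟩ := ih (A.erase x) (Finset.erase_ssubset hx) (k1 w x)
      (k1_nonneg hw x) (hk1T x) (hk1A x)
    exact ⟨I, h1.trans (Finset.erase_subset _ _), h2, h3⟩
  by_cases hbd : ∃ x ∈ A, w x = 0 ∨ w x = Real.exp L
  · obtain ⟨x, hx, hx2⟩ := hbd
    obtain ⟨I, h1, h2, h3⟩ := ih1 x hx
    refine ⟨I, h1, h2, le_trans ?_ h3⟩
    refine Finset.sum_le_sum fun v _ => mul_le_mul_of_nonneg_left ?_ (hc v)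
    by_cases hv : v = x
    · subst hv
      have : phi L (w v) = 0 := by
        rcases hx2 with h | h <;> rw [h]
        exacts [phi_zero L, phi_exp L]
      simp [f, this, k1, phi_zero]
    · have : k1 w x v = w v := by simp [k1, hv]
      unfold f
      rw [this]
      refine div_le_div_of_nonneg_left (phi_nonneg (hw v) (hT v))
        (lt_of_lt_of_le he (S_pos G he (k1_nonneg hw x) v)) (S_mono G e (fun u => ?_) v)
      unfold k1; split_ifs; exacts [hw u, le_rfl]
  · push Not at hbd
    rcases A.eq_empty_or_nonempty with hAe | hAne
    · refine ⟨∅, by simp, by simp [IsIndepFinset], ?_⟩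
      have : ∀ v, w v = 0 := fun v => hA v (by simp [hAe])
      simp [Ψ, f, this, phi_zero]
    have hpos : ∀ x ∈ A, 0 < w x := fun x hx => lt_of_le_of_ne (hw x) (hbd x hx).1.symm
    have hlt : ∀ x ∈ A, w x < Real.exp L := fun x hx => lt_of_le_of_ne (hT x) (hbd x hx).2
    have hloc : IsLocalMax
        (fun t : ℝ => ∑ v, c v * f G L e (fun u => w u + t * (w u * S G e w u)) v) 0 := by
      have hev : ∀ᶠ t : ℝ in nhds 0, ∀ u, u ∈ A → 0 < w u + t * (w u * S G e w u) ∧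
          w u + t * (w u * S G e w u) < Real.exp L := by
        rw [Filter.eventually_all]
        intro u
        by_cases hu : u ∈ A
        · have hct : Continuous fun t : ℝ => w u + t * (w u * S G e w u) := by fun_prop
          have t1 := (hct.continuousAt (x := 0)).eventually
            (isOpen_Ioo.mem_nhds (show (w u + 0 * (w u * S G e w u)) ∈ Set.Ioo 0 (Real.exp L) by
              simpa using ⟨hpos u hu, hlt u hu⟩))
          filter_upwards [t1] with t ht _ using ht
        · exact Filter.Eventually.of_forall fun t h => (hu h).elim
      filter_upwards [hev] with t ht
      have hz : (fun u => w u + 0 * (w u * S G e w u)) = w := by simp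
      simp only [hz]
      refine hwmax (show _ ∈ K from ⟨fun u => ?_, fun u => ?_, fun u hu => ?_⟩)
      · by_cases hu : u ∈ A
        · exact (ht u hu).1.le
        · simp [hA u hu]
      · by_cases hu : u ∈ A
        · exact (ht u hu).2.le
        · simpa [hA u hu] using (Real.exp_pos L).le
      · simp [hA u hu]
    have hstep := max_step G hG he c hc hw hT hloc
    by_contra hcon
    push Not at hcon
    have ih2 : ∀ x ∈ A, c x * κ + Ψ (k2 G w x) < Ψ w := by
      intro x hx
      obtain ⟨I, h1, h2, h3⟩ := ih (A.filter fun u => ¬ (u = x ∨ G.Adj x u))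
        (Finset.filter_ssubset.2 ⟨x, hx, by simp⟩) (k2 G w x) (k2_nonneg G hw x)
        (fun u => by unfold k2; split_ifs; exacts [(Real.exp_pos L).le, hT u])
        (fun u hu => by
          unfold k2
          split_ifs with h
          · rfl
          · exact hA u fun h' => hu (Finset.mem_filter.2 ⟨h', h⟩))
      have hxI : x ∉ I := fun h => by simpa using h1 h
      have hadj : ∀ u ∈ I, ¬ G.Adj x u := fun u hu h => by
        have := h1 hu
        simp [h] at this
      have := hcon (insert x I)
        (Finset.insert_subset hx (h1.trans (Finset.filter_subset _ _)))
        (by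
          intro u hu v hv
          rw [Finset.mem_insert] at hu hv
          rcases hu with rfl | hu <;> rcases hv with rfl | hv
          · exact G.irrefl
          · exact hadj v hv
          · exact fun h => hadj u hu h.symm
          · exact h2 u hu v hv)
      rw [Finset.sum_insert hxI] at this
      have h3' : Ψ (k2 G w x) ≤ κ * ∑ v ∈ I, c v := h3
      linarith
    have ih1' : ∀ x ∈ A, Ψ (k1 w x) < Ψ w := by
      intro x hx
      obtain ⟨I, h1, h2, h3⟩ := ih1 x hx
      exact lt_of_le_of_lt h3 (hcon I h1 h2)
    have s1 : ∑ x, w x * (c x * κ + Ψ (k2 G w x) - Ψ w) ≤ 0 := by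
      refine Finset.sum_nonpos fun x _ => ?_
      by_cases hx : x ∈ A
      · have := ih2 x hx
        exact mul_nonpos_of_nonneg_of_nonpos (hw x) (by linarith)
      · simp [hA x hx]
    have s2 : ∑ x, e * (Ψ (k1 w x) - Ψ w) < 0 := by
      have hle : ∀ x, e * (Ψ (k1 w x) - Ψ w) ≤ 0 := by
        intro x
        by_cases hx : x ∈ A
        · have := ih1' x hx
          exact mul_nonpos_of_nonneg_of_nonpos he.le (by linarith)
        · have : k1 w x = w := by
            funext u
            unfold k1
            split_ifs with h
            · subst h; exact (hA u hx).symm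
            · rfl
          simp [this]
      obtain ⟨x, hx⟩ := hAne
      refine Finset.sum_neg' (fun x _ => hle x) ⟨x, Finset.mem_univ x, ?_⟩
      have := ih1' x hx
      exact mul_neg_of_pos_of_neg he (by linarith)
    have : 0 ≤ ∑ x, w x * (c x * κ + Ψ (k2 G w x) - Ψ w) + ∑ x, e * (Ψ (k1 w x) - Ψ w) := hstep
    linarith

/-- LP duality. -/
lemma dual {V : Type*} [Fintype V] [DecidableEq V] (G : SimpleGraph V) (t : V → ℝ)
    (h : ∀ c : V → ℝ, (∀ v, 0 ≤ c v) → ∃ I : Finset V, IsIndepFinset G I ∧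
      ∑ v, c v * t v ≤ ∑ v ∈ I, c v) :
    ∃ p : Finset V → ℝ, (∀ I, 0 ≤ p I) ∧ (∀ I, p I ≠ 0 → IsIndepFinset G I) ∧
      (∑ I : Finset V, p I) = 1 ∧
      ∀ v, t v ≤ ∑ I ∈ Finset.univ.filter (fun I : Finset V => v ∈ I), p I := by
  classical
  let ι := {I : Finset V // IsIndepFinset G I}
  let Φ : (ι → ℝ) →ₗ[ℝ] (V → ℝ) :=
    { toFun := fun q v => ∑ i : ι, q i * (if v ∈ i.1 then 1 else 0)
      map_add' := by
        intro a b; funext v; simp only [Pi.add_apply, add_mul, Finset.sum_add_distrib]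
      map_smul' := by
        intro a b; funext v; simp only [Pi.smul_apply, smul_eq_mul, RingHom.id_apply, Finset.mul_sum, mul_assoc] }
  have hΦc : Continuous Φ := Φ.continuous_of_finiteDimensional
  let C : Set (V → ℝ) := Φ '' stdSimplex ℝ ι
  let D : Set (V → ℝ) := Set.Ici t
  by_cases hCD : Disjoint C D
  · exfalso
    obtain ⟨F, a, b, h1, h2, h3⟩ := geometric_hahn_banach_compact_closed
      ((convex_stdSimplex ℝ ι).linear_image Φ) ((isCompact_stdSimplex ℝ ι).image hΦc)
      (convex_Ici t) isClosed_Ici hCD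
    let c : V → ℝ := fun v => F (Pi.single v 1)
    have hF : ∀ x, F x = ∑ v, c v * x v := by
      intro x
      conv_lhs => rw [pi_eq_sum_univ' x]
      rw [map_sum]
      refine Finset.sum_congr rfl fun v _ => ?_
      rw [map_smul, smul_eq_mul, mul_comm]
    have hc : ∀ v, 0 ≤ c v := by
      intro v
      by_contra hneg
      push Not at hneg
      have key : ∀ s : ℝ, 0 ≤ s → b < F t + s * c v := by
        intro s hs
        have := h3 (t + s • Pi.single v 1) (by
          change t ≤ _
          refine le_add_of_nonneg_right ?_
          exact smul_nonneg hs (by rw [Pi.single_nonneg]; norm_num))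
        simpa [map_add, map_smul] using this
      have h5 := key 0 le_rfl
      have := key ((F t - b) / (- c v)) (div_nonneg (by linarith) (by linarith))
      rw [div_mul_eq_mul_div, div_neg, mul_div_assoc, div_self hneg.ne] at this
      linarith
    obtain ⟨I, hI, hle⟩ := h c hc
    have hm := h1 (Φ (Pi.single ⟨I, hI⟩ 1)) ⟨_, single_mem_stdSimplex ℝ _, rfl⟩
    have ht := h3 t (Set.mem_Ici.2 le_rfl)
    rw [hF] at hm ht
    have : ∑ v, c v * Φ (Pi.single (⟨I, hI⟩ : ι) 1) v = ∑ v ∈ I, c v := by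
      have e1 : ∀ v, Φ (Pi.single (⟨I, hI⟩ : ι) 1) v = if v ∈ I then 1 else 0 := by
        intro v
        change ∑ i : ι, (Pi.single (⟨I, hI⟩ : ι) (1 : ℝ) : ι → ℝ) i * (if v ∈ i.1 then 1 else 0) = _
        rw [Finset.sum_eq_single (⟨I, hI⟩ : ι)]
        · simp
        · intro b _ hb
          simp [hb]
        · simp
      simp [e1]
    linarith
  · rw [Set.not_disjoint_iff] at hCD
    obtain ⟨y, ⟨q, hq, rfl⟩, hy⟩ := hCD
    have hconv : ∀ g : Finset V → ℝ, ∑ I : Finset V, (if hI : IsIndepFinset G I then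
        q ⟨I, hI⟩ * g I else 0) = ∑ i : ι, q i * g i.1 := by
      intro g
      have := Finset.sum_subtype_of_mem (s := Finset.univ.filter fun I => IsIndepFinset G I)
        (p := fun I => IsIndepFinset G I) (fun I => if hI : IsIndepFinset G I then
        q ⟨I, hI⟩ * g I else 0) (by simp)
      rw [Finset.sum_filter_of_ne (by
        intro I _ hne
        by_contra hh
        simp [hh] at hne)] at this
      rw [← this]
      have hu : Finset.subtype (fun I => IsIndepFinset G I)
        (Finset.univ.filter fun I => IsIndepFinset G I) = Finset.univ := by
        ext ⟨x, hx⟩; simp [hx]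
      rw [hu]
      refine Finset.sum_congr rfl fun i _ => ?_
      rw [dif_pos i.2]
    refine ⟨fun I => if hI : IsIndepFinset G I then q ⟨I, hI⟩ else 0, ?_, ?_, ?_, ?_⟩
    · intro I
      dsimp only
      split_ifs
      exacts [hq.1 _, le_rfl]
    · intro I hI
      by_contra hh
      simp [hh] at hI
    · have := hconv (fun _ => 1)
      simp only [mul_one] at this
      rw [this]
      exact hq.2
    · intro v
      have h1 := hconv (fun I => if v ∈ I then 1 else 0)
      have h2 : t v ≤ Φ q v := hy v
      refine h2.trans (le_of_eq ?_)
      change ∑ i : ι, q i * (if v ∈ i.1 then 1 else 0) = _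
      rw [← h1, Finset.sum_filter]
      refine Finset.sum_congr rfl fun I _ => ?_
      split_ifs <;> simp_all

end TriFree

namespace TriFree

lemma nbhd {V : Type*} [Fintype V] [DecidableEq V] [Nonempty V] (G : SimpleGraph V)
    (hG : G.CliqueFree 3) (c : V → ℝ) :
    ∃ I : Finset V, IsIndepFinset G I ∧
      ∑ v, c v * ((∑ u, aw G v u) / Fintype.card V) ≤ ∑ v ∈ I, c v := by
  classical
  have hn : (0:ℝ) < Fintype.card V := by exact_mod_cast Fintype.card_pos
  have hex : ∃ u ∈ (Finset.univ : Finset V),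
      ∑ v, c v * ((∑ u, aw G v u) / Fintype.card V) ≤ ∑ v, c v * aw G v u := by
    refine Finset.exists_le_of_sum_le Finset.univ_nonempty ?_
    rw [Finset.sum_const, Finset.card_univ, nsmul_eq_mul, Finset.mul_sum]
    conv_rhs => rw [Finset.sum_comm]
    refine le_of_eq (Finset.sum_congr rfl fun v _ => ?_)
    rw [← Finset.mul_sum]
    field_simp
  obtain ⟨u, _, hu⟩ := hex
  refine ⟨Finset.univ.filter fun v => G.Adj v u, ?_, ?_⟩
  · intro a ha b hb hab
    simp only [Finset.mem_filter, Finset.mem_univ, true_and] at ha hb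
    exact hG {a, b, u} (SimpleGraph.is3Clique_triple_iff.2 ⟨hab, ha, hb⟩)
  · refine hu.trans (le_of_eq ?_)
    rw [Finset.sum_filter]
    refine Finset.sum_congr rfl fun v _ => ?_
    unfold aw
    split_ifs <;> simp

lemma eps_exists (δ : ℝ) (hδ : 0 < δ) : ∃ ε : ℝ, 0 < ε ∧ ε < 1 / 2 ∧
    1 / (Real.sqrt 2 + δ) ≤ Real.sqrt ((1 / 2 - ε) / (1 + ε)) - ε / 2 := by
  have hc : ContinuousAt (fun ε : ℝ => Real.sqrt ((1 / 2 - ε) / (1 + ε)) - ε / 2) 0 := by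
    refine ContinuousAt.sub (ContinuousAt.sqrt (ContinuousAt.div ?_ ?_ ?_)) ?_
    · fun_prop
    · fun_prop
    · norm_num
    · fun_prop
  have h0 : 1 / (Real.sqrt 2 + δ) <
      (fun ε : ℝ => Real.sqrt ((1 / 2 - ε) / (1 + ε)) - ε / 2) 0 := by
    have h2 : 0 < Real.sqrt 2 := by positivity
    have : (fun ε : ℝ => Real.sqrt ((1 / 2 - ε) / (1 + ε)) - ε / 2) 0 = 1 / Real.sqrt 2 := by
      simp
    rw [this]
    exact one_div_lt_one_div_of_lt h2 (by linarith)
  have h1 := hc.eventually (lt_mem_nhds h0)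
  have h2 : ∀ᶠ ε : ℝ in nhdsWithin 0 (Set.Ioi 0), 1 / (Real.sqrt 2 + δ) <
      Real.sqrt ((1 / 2 - ε) / (1 + ε)) - ε / 2 := h1.filter_mono nhdsWithin_le_nhds
  have h3 : ∀ᶠ ε : ℝ in nhdsWithin 0 (Set.Ioi 0), ε < 1 / 2 :=
    (gt_mem_nhds (by norm_num)).filter_mono nhdsWithin_le_nhds
  obtain ⟨ε, ha, hb, hd⟩ := (h2.and (h3.and self_mem_nhdsWithin)).exists
  exact ⟨ε, hd, hb, ha.le⟩

lemma large_exists (ε : ℝ) (hε : 0 < ε) : ∃ n₁ : ℕ, ∀ n : ℕ, n₁ ≤ n →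
    1 ≤ Real.log n ∧ 2 * Real.exp (-(ε * Real.log n)) ≤ ε ^ 2 := by
  have hlog : Filter.Tendsto (fun n : ℕ => Real.log n) Filter.atTop Filter.atTop :=
    Real.tendsto_log_atTop.comp tendsto_natCast_atTop_atTop
  have h1 := hlog.eventually_ge_atTop 1
  have ht : Filter.Tendsto (fun n : ℕ => Real.exp (-(ε * Real.log n))) Filter.atTop (nhds 0) :=
    Real.tendsto_exp_neg_atTop_nhds_zero.comp (hlog.const_mul_atTop hε)
  have h2 := ht.eventually (gt_mem_nhds (show (0:ℝ) < ε ^ 2 / 2 by positivity))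
  obtain ⟨n₁, h⟩ := Filter.eventually_atTop.1 (h1.and h2)
  exact ⟨n₁, fun n hn => ⟨(h n hn).1, by linarith [(h n hn).2]⟩⟩

lemma numeric {ε N l d q : ℝ} (hε : 0 < ε) (hε2 : ε < 1 / 2) (hN : 0 < N) (hl : 1 ≤ l)
    (hd : 0 ≤ d) (hq : q ≤ Real.sqrt ((1 / 2 - ε) / (1 + ε)) - ε / 2) :
    q * Real.sqrt (l / N) ≤
      ((1 / 2 - ε) * l / (ε * Real.sqrt (N * l) + d) / (1 + ε) + d / N) / 2 := by
  set a := Real.sqrt ((1 / 2 - ε) / (1 + ε)) with ha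
  set r := Real.sqrt (l / N) with hr
  have hr0 : 0 < r := Real.sqrt_pos.2 (by positivity)
  have ha2 : a ^ 2 = (1 / 2 - ε) / (1 + ε) := Real.sq_sqrt (div_nonneg (by linarith) (by linarith))
  have hr2 : r ^ 2 = l / N := Real.sq_sqrt (by positivity)
  have hNr : Real.sqrt (N * l) = N * r := by
    rw [Real.sqrt_eq_iff_mul_self_eq_of_pos (by positivity)]
    have : N * r * (N * r) = N ^ 2 * r ^ 2 := by ring
    rw [this, hr2]; field_simp
  rw [hNr]
  set y := ε * (N * r) + d with hy
  have hy0 : 0 < y := by positivity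
  have hl' : l = r ^ 2 * N := by rw [hr2]; field_simp
  have e1 : (1 / 2 - ε) * l / y / (1 + ε) = a ^ 2 * r ^ 2 * N / y := by
    rw [ha2, hl']; field_simp
  have e2 : d / N = y / N - ε * r := by rw [hy]; field_simp; ring
  have e3 : 2 * a * r ≤ a ^ 2 * r ^ 2 * N / y + y / N := by
    have : a ^ 2 * r ^ 2 * N / y + y / N - 2 * a * r = (a * r * N - y) ^ 2 / (y * N) := by
      field_simp; ring
    have h2 : 0 ≤ (a * r * N - y) ^ 2 / (y * N) := by positivity
    linarith
  rw [e1, e2]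
  have := mul_le_mul_of_nonneg_right hq hr0.le
  linarith

end TriFree

/-- for every `δ > 0` there is `n₁` such that every triangle-free graph
on `n ≥ n₁` vertices has a probability distribution on its independent sets covering every
vertex with probability at least `(1/(√2 + δ))·√(ln n / n)`; equivalently, its fractional
chromatic number is at most `(√2 + o(1))·√(n/ln n)`. -/
theorem fracChromatic_of_triangle_free (δ : ℝ) (hδ : 0 < δ) :
    ∃ n₁ : ℕ, ∀ (V : Type) [Fintype V] [DecidableEq V] (G : SimpleGraph V),
      G.CliqueFree 3 → n₁ ≤ Fintype.card V →
      ∃ p : Finset V → ℝ,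
        (∀ I, 0 ≤ p I) ∧
        (∀ I, p I ≠ 0 → IsIndepFinset G I) ∧
        (∑ I : Finset V, p I) = 1 ∧
        ∀ v : V,
          (1 / (Real.sqrt 2 + δ)) *
              Real.sqrt (Real.log (Fintype.card V) / (Fintype.card V)) ≤
            ∑ I ∈ Finset.univ.filter (fun I : Finset V => v ∈ I), p I := by
  obtain ⟨ε, hε, hε2, hq⟩ := TriFree.eps_exists δ hδ
  obtain ⟨n₁, hn₁⟩ := TriFree.large_exists ε hε
  refine ⟨max n₁ 1, fun V _ _ G hG hcard => ?_⟩
  have hn1 : 1 ≤ Fintype.card V := le_trans (le_max_right _ _) hcard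
  obtain ⟨hl, hex⟩ := hn₁ _ (le_trans (le_max_left _ _) hcard)
  have : Nonempty V := Fintype.card_pos_iff.1 hn1
  set N : ℝ := (Fintype.card V : ℝ) with hNdef
  have hN : 0 < N := by rw [hNdef]; exact_mod_cast hn1
  set l := Real.log N with hldef
  refine TriFree.dual G (fun _ => (1 / (Real.sqrt 2 + δ)) * Real.sqrt (l / N)) ?_
  intro c hc
  set L := (1 / 2 - ε) * l with hL
  have hL0 : 0 ≤ L := mul_nonneg (by linarith) (by linarith)
  set e := ε * Real.sqrt (N * l) with he
  have hsl : 1 ≤ Real.sqrt l := Real.one_le_sqrt.2 hl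
  have hsN : 0 < Real.sqrt N := Real.sqrt_pos.2 hN
  have he0 : 0 < e := by
    have : 0 < N * l := by positivity
    positivity
  have hκ : 1 + 2 * Real.exp L / e ≤ 1 + ε := by
    have h1 : Real.exp L = Real.sqrt N * Real.exp (-(ε * l)) := by
      have : Real.sqrt N = Real.exp (l / 2) := by
        rw [Real.exp_half, hldef, Real.exp_log hN]
      rw [this, ← Real.exp_add, hL]
      congr 1; ring
    have h2 : 2 * Real.exp L / e ≤ ε := by
      rw [div_le_iff₀ he0, h1, he, Real.sqrt_mul hN.le]
      have h3 := mul_le_mul_of_nonneg_left hex hsN.le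
      have h4 : ε ^ 2 * Real.sqrt N * 1 ≤ ε ^ 2 * Real.sqrt N * Real.sqrt l :=
        mul_le_mul_of_nonneg_left hsl (by positivity)
      nlinarith
    linarith
  obtain ⟨I₁, -, hI₁, h1⟩ := TriFree.key G hG (L := L) he0 c hc Finset.univ (fun _ => 1)
    (fun _ => zero_le_one) (fun _ => Real.one_le_exp hL0) (fun u hu => (hu (Finset.mem_univ u)).elim)
  obtain ⟨I₂, hI₂, h2⟩ := TriFree.nbhd G hG c
  have h1' : ∑ v, c v * (L / (e + ∑ u, TriFree.aw G v u) / (1 + ε)) ≤ ∑ v ∈ I₁, c v := by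
    have hcI : 0 ≤ ∑ v ∈ I₁, c v := Finset.sum_nonneg fun v _ => hc v
    have h3 := h1.trans (mul_le_mul_of_nonneg_right hκ hcI)
    have h4 : ∑ v, c v * (L / (e + ∑ u, TriFree.aw G v u) / (1 + ε))
        = (∑ v, c v * TriFree.f G L e (fun _ => 1) v) / (1 + ε) := by
      rw [Finset.sum_div]
      refine Finset.sum_congr rfl fun v _ => ?_
      simp only [TriFree.f, TriFree.phi, TriFree.S, Real.log_one, sub_zero, one_mul, mul_one]
      ring
    rw [h4, div_le_iff₀ (by linarith)]
    linarith
  have hsum : ∑ v, c v * ((1 / (Real.sqrt 2 + δ)) * Real.sqrt (l / N)) ≤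
      (∑ v ∈ I₁, c v + ∑ v ∈ I₂, c v) / 2 := by
    have h5 : ∑ v, c v * ((1 / (Real.sqrt 2 + δ)) * Real.sqrt (l / N)) ≤
        ∑ v, c v * ((L / (e + ∑ u, TriFree.aw G v u) / (1 + ε)
          + (∑ u, TriFree.aw G v u) / N) / 2) := by
      refine Finset.sum_le_sum fun v _ => mul_le_mul_of_nonneg_left ?_ (hc v)
      exact TriFree.numeric hε hε2 hN hl
        (Finset.sum_nonneg fun u _ => TriFree.aw_nonneg G v u) hq
    have h6 : ∑ v, c v * ((L / (e + ∑ u, TriFree.aw G v u) / (1 + ε)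
          + (∑ u, TriFree.aw G v u) / N) / 2)
        = (∑ v, c v * (L / (e + ∑ u, TriFree.aw G v u) / (1 + ε))
          + ∑ v, c v * ((∑ u, TriFree.aw G v u) / N)) / 2 := by
      rw [← Finset.sum_add_distrib, Finset.sum_div]
      exact Finset.sum_congr rfl fun v _ => by ring
    rw [h6] at h5
    linarith
  by_cases hcmp : ∑ v ∈ I₁, c v ≤ ∑ v ∈ I₂, c v
  · exact ⟨I₂, hI₂, by linarith⟩
  · exact ⟨I₁, hI₁, by linarith⟩
end
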